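/- arXiv:math/0602575 — 4 statements merged into one kernel-verified Lean document; each statement's English description precedes it below -/
import Mathlib

section
/- Theorem 4 (Matrix-Forest Theorem for digraphs, cofactor form). For any weighted digraph Γ on a finite vertex set V = {1,…,n} and any vertices i, j ∈ V, W^{ij} = ε(𝔉^{i→j}), i.e., the cofactor of the (i,j) entry of W = I + L(Γ) equals the sum of the weights of those spanning diverging forests of Γ in which j belongs to the tree diverging from i. -/
open scoped Classical

/-- The Kirchhoff (Laplacian) matrix of a weighted digraph on vertex set `α` with arc
weights `ε`: `ℓ i j = -ε j i` for `j ≠ i`, and `ℓ i i = ∑_{k ≠ i} ε k i`. -/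
noncomputable def kirchhoff {α : Type*} [Fintype α] [DecidableEq α]
    (ε : α → α → ℝ) : Matrix α α ℝ :=
  Matrix.of fun i j =>
    if i = j then ∑ k ∈ Finset.univ.erase i, ε k i else - ε j i

/-- `F` is a spanning diverging forest: every arc joins distinct vertices, every vertex
has at most one incoming arc, and there are no cycles. -/
def IsDivForest {α : Type*} [Fintype α] [DecidableEq α] (F : Finset (α × α)) : Prop :=
  (∀ p ∈ F, p.1 ≠ p.2) ∧
  (∀ b : α, (F.filter fun p => p.2 = b).card ≤ 1) ∧
  ∀ a : α, ¬ Relation.TransGen (fun x y : α => (x, y) ∈ F) a a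

/-- The weight of a set of arcs: the product of the arc weights. -/
noncomputable def arcWt {α : Type*} (ε : α → α → ℝ) (F : Finset (α × α)) : ℝ :=
  ∏ p ∈ F, ε p.1 p.2

/-- The set of roots of `F`, i.e. the vertices of in-degree 0. -/
noncomputable def rootSet {α : Type*} [Fintype α] [DecidableEq α]
    (F : Finset (α × α)) : Finset α :=
  Finset.univ.filter fun v => ∀ a, (a, v) ∉ F

/-- The set of all spanning diverging forests. -/
noncomputable def divForests (α : Type*) [Fintype α] [DecidableEq α] :
    Finset (Finset (α × α)) :=
  Finset.univ.filter IsDivForest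

/-- The set `𝔉^{i→j}` of spanning diverging forests in which `i` is a root and there is
a directed path from `i` to `j`. -/
noncomputable def divForestsFromTo {α : Type*} [Fintype α] [DecidableEq α] (i j : α) :
    Finset (Finset (α × α)) :=
  Finset.univ.filter fun F => IsDivForest F ∧ (∀ a, (a, i) ∉ F) ∧
    Relation.ReflTransGen (fun x y : α => (x, y) ∈ F) i j

/-- The cofactor of the `(i,j)` entry of `M`: `(-1)^(i+j)` times the determinant of the
matrix obtained from `M` by deleting row `i` and column `j`. -/
noncomputable def cofactor {m : ℕ} (M : Matrix (Fin (m + 1)) (Fin (m + 1)) ℝ)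
    (i j : Fin (m + 1)) : ℝ :=
  (-1 : ℝ) ^ ((i : ℕ) + (j : ℕ)) * (M.submatrix i.succAbove j.succAbove).det


/-- Rows of the elementary matrices in the multilinear expansion. -/
noncomputable def mfRow {α : Type*} [Fintype α] [DecidableEq α] (i j b : α) (o : Option α) :
    α → ℝ :=
  if b = i then Pi.single j 1 else Pi.single b 1 - o.elim 0 (fun a => Pi.single a 1)

/-- Coefficients in the multilinear expansion. -/
noncomputable def mfCoef {α : Type*} [Fintype α] [DecidableEq α] (ε : α → α → ℝ) (i b : α)
    (o : Option α) : ℝ :=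
  if b = i then (if o = none then 1 else 0) else o.elim 1 (fun a => ε a b)

/-- The matrix attached to a parent function. -/
noncomputable def mfMat {α : Type*} [Fintype α] [DecidableEq α] (i j : α) (f : α → Option α) :
    Matrix α α ℝ :=
  Matrix.of fun b => mfRow i j b (f b)

/-- The arc relation of a parent function. -/
def mfRel {α : Type*} (f : α → Option α) (x y : α) : Prop := f y = some x

/-- The good parent functions. -/
def mfGood {α : Type*} (i j : α) (f : α → Option α) : Prop :=
  f i = none ∧ (∀ a, ¬ Relation.TransGen (mfRel f) a a) ∧ Relation.ReflTransGen (mfRel f) i j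

lemma mf_sum_row {α : Type*} [Fintype α] [DecidableEq α] (ε : α → α → ℝ)
    (hdiag : ∀ a, ε a a = 0) (i j b : α) :
    ((1 + kirchhoff ε).updateRow i (Pi.single j 1)) b
      = ∑ o : Option α, mfCoef ε i b o • mfRow i j b o := by
  by_cases h : b = i
  · subst h
    simp [mfCoef, mfRow, Fintype.sum_option]
  · rw [Matrix.updateRow_ne h]
    funext k
    simp only [mfCoef, mfRow, h, if_false, Fintype.sum_option, Option.elim, Pi.add_apply,
      Finset.sum_apply, Pi.smul_apply, Pi.sub_apply, smul_eq_mul, Matrix.add_apply, kirchhoff,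
      Matrix.of_apply, Pi.zero_apply, mul_sub, Finset.sum_sub_distrib]
    have e1 : ∑ k ∈ Finset.univ.erase b, ε k b = ∑ k, ε k b := by
      rw [← Finset.add_sum_erase _ _ (Finset.mem_univ b), hdiag, zero_add]
    rw [e1]
    by_cases hk : b = k
    · subst hk
      simp [Pi.single_apply, hdiag]
    · simp [Pi.single_apply, hk, Ne.symm hk, Matrix.one_apply]

lemma mf_expand {α : Type*} [Fintype α] [DecidableEq α] (ε : α → α → ℝ)
    (hdiag : ∀ a, ε a a = 0) (i j : α) :
    ((1 + kirchhoff ε).updateRow i (Pi.single j 1)).det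
      = ∑ f : α → Option α, (∏ b, mfCoef ε i b (f b)) * (mfMat i j f).det := by
  have h : ((1 + kirchhoff ε).updateRow i (Pi.single j 1))
      = fun b => ∑ o : Option α, mfCoef ε i b o • mfRow i j b o := by
    funext b
    exact mf_sum_row ε hdiag i j b
  rw [h]
  have h2 := (Matrix.detRowAlternating (R := ℝ) (n := α)).toMultilinearMap.map_sum
    (fun b (o : Option α) => mfCoef ε i b o • mfRow i j b o)
  refine h2.trans (Finset.sum_congr rfl fun f _ => ?_)
  exact (Matrix.detRowAlternating (R := ℝ) (n := α)).toMultilinearMap.map_smul_univ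
    (fun b => mfCoef ε i b (f b)) (fun b => mfRow i j b (f b))

lemma mf_det_zero {α : Type*} [Fintype α] [DecidableEq α] (i j : α) (f : α → Option α)
    (S : α → Prop) (hn : ∀ b, b ≠ i → f b = none → ¬ S b)
    (hs : ∀ b a, b ≠ i → f b = some a → (S b ↔ S a)) (hj : ¬ S j) (hne : ∃ b, S b) :
    (mfMat i j f).det = 0 := by
  rw [← Matrix.exists_mulVec_eq_zero_iff]
  refine ⟨fun b => if S b then 1 else 0, ?_, ?_⟩
  · obtain ⟨b, hb⟩ := hne
    intro h
    have := congrFun h b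
    simp [hb] at this
  · funext b
    change mfRow i j b (f b) ⬝ᵥ _ = 0
    by_cases h : b = i
    · simp [mfRow, h, hj]
    · cases hf : f b with
      | none => simp [mfRow, h, hn b h hf]
      | some a => simp [mfRow, h, sub_dotProduct, hs b a h hf]

lemma mf_det_step {α : Type*} [Fintype α] [DecidableEq α] (i j k : α) (f : α → Option α)
    (hk : k ≠ i) (hf : f k = some j) : (mfMat i k f).det = (mfMat i j f).det := by
  have h : mfMat i k f = (mfMat i j f).updateRow i (mfMat i j f i + mfMat i j f k) := by
    funext b
    by_cases hb : b = i
    · subst hb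
      rw [Matrix.updateRow_self]
      change mfRow b k b (f b) = mfRow b j b (f b) + mfRow b j k (f k)
      simp [mfRow, hk, hf]
    · rw [Matrix.updateRow_ne hb]
      change mfRow i k b (f b) = mfRow i j b (f b)
      simp [mfRow, hb]
  rw [h, Matrix.det_updateRow_add_self _ hk.symm]

lemma mf_det_path {α : Type*} [Fintype α] [DecidableEq α] (i j : α) (f : α → Option α)
    (hi : f i = none) (hp : Relation.ReflTransGen (mfRel f) i j) :
    (mfMat i j f).det = (mfMat i i f).det := by
  induction hp with
  | refl => rfl
  | tail _ h ih =>
    rw [← ih]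
    refine mf_det_step _ _ _ _ ?_ h
    rintro rfl
    simp [mfRel, hi] at h

lemma mf_det_base {α : Type*} [Fintype α] [DecidableEq α] (i : α) (f : α → Option α)
    (hac : ∀ a, ¬ Relation.TransGen (mfRel f) a a) :
    (mfMat i i f).det = 1 := by
  let d : α → ℕ := fun b => (Finset.univ.filter fun x => Relation.TransGen (mfRel f) x b).card
  have hd : ∀ a b, f b = some a → d a < d b := by
    intro a b h
    apply Finset.card_lt_card
    refine ⟨fun x hx => ?_, fun hsub => ?_⟩
    · simp only [Finset.mem_filter, Finset.mem_univ, true_and] at hx ⊢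
      exact hx.tail h
    · have := @hsub a (by
        simp only [Finset.mem_filter, Finset.mem_univ, true_and]
        exact Relation.TransGen.single h)
      simp only [Finset.mem_filter, Finset.mem_univ, true_and] at this
      exact hac a this
  have hent : ∀ b c, d b ≤ d c → mfMat i i f b c = (1 : Matrix α α ℝ) b c := by
    intro b c hbc
    by_cases h : b = i
    · subst h
      simp [mfMat, mfRow, Matrix.one_apply, Pi.single_apply, eq_comm]
    · cases hf : f b with
      | none => simp [mfMat, mfRow, h, hf, Matrix.one_apply, Pi.single_apply, eq_comm (a := c)]
      | some a =>
        have hca : c ≠ a := by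
          rintro rfl
          exact absurd (hd _ _ hf) (not_lt.mpr hbc)
        simp [mfMat, mfRow, h, hf, Matrix.one_apply, Pi.single_apply, hca, eq_comm (a := c) (b := b)]
  have hbt : Matrix.BlockTriangular (mfMat i i f) (fun b => OrderDual.toDual (d b)) := by
    intro b c hbc
    have hlt : d b < d c := hbc
    rw [hent b c hlt.le, Matrix.one_apply_ne]
    rintro rfl
    exact lt_irrefl _ hlt
  rw [hbt.det]
  refine Finset.prod_eq_one fun k _ => ?_
  have : (mfMat i i f).toSquareBlock (fun b => OrderDual.toDual (d b)) k = 1 := by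
    ext ⟨b, hb⟩ ⟨c, hc⟩
    have hbc : d b = d c := OrderDual.toDual.injective (hb.trans hc.symm)
    rw [Matrix.toSquareBlock_def, Matrix.of_apply, hent b c hbc.le]
    simp [Matrix.one_apply, Subtype.ext_iff]
  rw [this, Matrix.det_one]

lemma mf_det {α : Type*} [Fintype α] [DecidableEq α] (i j : α) (f : α → Option α)
    (hi : f i = none) : (mfMat i j f).det = if mfGood i j f then 1 else 0 := by
  by_cases hp : Relation.ReflTransGen (mfRel f) i j
  · by_cases hac : ∀ a, ¬ Relation.TransGen (mfRel f) a a
    · rw [if_pos ⟨hi, hac, hp⟩, mf_det_path i j f hi hp, mf_det_base i f hac]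
    · rw [if_neg fun h => hac h.2.1]
      push Not at hac
      obtain ⟨a, ha⟩ := hac
      let S : α → Prop := fun b => Relation.TransGen (mfRel f) a b
      have hn : ∀ b, f b = none → ¬ S b := by
        intro b hb h
        obtain ⟨c, -, hc⟩ := Relation.TransGen.tail'_iff.mp h
        simp [mfRel, hb] at hc
      have hs : ∀ b c, f b = some c → (S b ↔ S c) := by
        intro b c hb
        refine ⟨fun h => ?_, fun h => h.tail hb⟩
        obtain ⟨c', h1, hc⟩ := Relation.TransGen.tail'_iff.mp h
        have : c' = c := by
          simp only [mfRel, hb, Option.some.injEq] at hc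
          exact hc.symm
        subst this
        exact ha.trans_left h1
      refine mf_det_zero i j f S (fun b _ => hn b) (fun b c _ => hs b c) ?_ ⟨a, ha⟩
      clear ha
      induction hp with
      | refl => exact hn i hi
      | tail _ h ih => rwa [hs _ _ h]
  · rw [if_neg fun h => hp h.2.2]
    refine mf_det_zero i j f (fun b => Relation.ReflTransGen (mfRel f) i b) ?_ ?_ hp ⟨i, .refl⟩
    · intro b hbi hb h
      rcases Relation.ReflTransGen.cases_tail h with h | ⟨c, -, hc⟩
      · exact hbi h
      · simp [mfRel, hb] at hc
    · intro b c hbi hb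
      refine ⟨fun h => ?_, fun h => h.tail hb⟩
      rcases Relation.ReflTransGen.cases_tail h with h | ⟨c', h1, hc⟩
      · exact absurd h hbi
      · simp only [mfRel, hb, Option.some.injEq] at hc
        exact hc ▸ h1

/-- Arc set of a parent function. -/
noncomputable def mfArcs {α : Type*} [Fintype α] [DecidableEq α] (f : α → Option α) :
    Finset (α × α) :=
  Finset.univ.filter fun p => f p.2 = some p.1

lemma mf_mem_arcs {α : Type*} [Fintype α] [DecidableEq α] (f : α → Option α) (x y : α) :
    (x, y) ∈ mfArcs f ↔ f y = some x := by
  simp [mfArcs]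

lemma mf_arcs_rel {α : Type*} [Fintype α] [DecidableEq α] (f : α → Option α) :
    (fun x y : α => (x, y) ∈ mfArcs f) = mfRel f := by
  funext x y
  simp [mfArcs, mfRel]

lemma mf_wt {α : Type*} [Fintype α] [DecidableEq α] (ε : α → α → ℝ) (i : α) (f : α → Option α)
    (hi : f i = none) : ∏ b, mfCoef ε i b (f b) = arcWt ε (mfArcs f) := by
  unfold arcWt mfArcs
  rw [Finset.prod_filter, Fintype.prod_prod_type_right]
  refine Finset.prod_congr rfl fun b _ => ?_
  cases hb : f b with
  | none => simp [mfCoef, hb]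
  | some a =>
    have : b ≠ i := by
      rintro rfl
      simp [hi] at hb
    simp [mfCoef, this, hb]

lemma mf_sum {α : Type*} [Fintype α] [DecidableEq α] (ε : α → α → ℝ)
    (hdiag : ∀ a, ε a a = 0) (i j : α) :
    ((1 + kirchhoff ε).updateRow i (Pi.single j 1)).det
      = ∑ F ∈ divForestsFromTo i j, arcWt ε F := by
  rw [mf_expand ε hdiag]
  have h1 : ∀ f : α → Option α, (∏ b, mfCoef ε i b (f b)) * (mfMat i j f).det
      = if mfGood i j f then arcWt ε (mfArcs f) else 0 := by
    intro f
    by_cases hi : f i = none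
    · rw [mf_det i j f hi, mf_wt ε i f hi]
      split_ifs <;> simp
    · rw [if_neg fun h => hi h.1, Finset.prod_eq_zero (Finset.mem_univ i), zero_mul]
      simp [mfCoef, hi]
  rw [Finset.sum_congr rfl fun f _ => h1 f, ← Finset.sum_filter]
  refine Finset.sum_bij (fun f _ => mfArcs f) ?_ ?_ ?_ ?_
  · intro f hf
    obtain ⟨hi, hac, hp⟩ := (Finset.mem_filter.mp hf).2
    refine Finset.mem_filter.mpr ⟨Finset.mem_univ _, ⟨?_, ?_, ?_⟩, ?_, ?_⟩
    · rintro ⟨x, y⟩ hxy h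
      have h' : x = y := h
      subst h'
      exact hac x (Relation.TransGen.single ((mf_mem_arcs f x x).mp hxy))
    · intro b
      rw [Finset.card_le_one]
      rintro ⟨x, y⟩ hx ⟨x', y'⟩ hx'
      simp only [Finset.mem_filter, mf_mem_arcs] at hx hx'
      obtain ⟨h1, rfl⟩ := hx
      obtain ⟨h2, rfl⟩ := hx'
      rw [h1] at h2
      simpa using h2
    · rw [mf_arcs_rel]
      exact hac
    · intro a
      rw [mf_mem_arcs, hi]
      simp
    · rw [mf_arcs_rel]
      exact hp
  · intro f _ g _ h
    funext b
    apply Option.ext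
    intro a
    have := congrArg (fun F => (a, b) ∈ F) h
    simpa only [mf_mem_arcs, eq_iff_iff] using this
  · intro F hF
    obtain ⟨⟨-, hc, hac⟩, hr, hp⟩ := (Finset.mem_filter.mp hF).2
    let f : α → Option α := fun b => if h : ∃ a, (a, b) ∈ F then some h.choose else none
    have hfF : mfArcs f = F := by
      ext ⟨x, y⟩
      rw [mf_mem_arcs]
      by_cases h : ∃ a, (a, y) ∈ F
      · have e : f y = some h.choose := dif_pos h
        rw [e, Option.some.injEq]
        constructor
        · rintro rfl
          exact h.choose_spec
        · intro hx
          have := Finset.card_le_one.mp (hc y) (h.choose, y) (by simp [h.choose_spec])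
            (x, y) (by simp [hx])
          exact congrArg Prod.fst this
      · have e : f y = none := dif_neg h
        rw [e]
        simp only [reduceCtorEq, false_iff]
        exact fun hx => h ⟨x, hx⟩
    refine ⟨f, Finset.mem_filter.mpr ⟨Finset.mem_univ _, ?_, ?_, ?_⟩, hfF⟩
    · exact dif_neg fun ⟨a, ha⟩ => hr a ha
    · rw [← mf_arcs_rel, hfF]
      exact hac
    · rw [← mf_arcs_rel, hfF]
      exact hp
  · intro f _
    rfl

/-- **Theorem 4** (Matrix-Forest Theorem for digraphs, cofactor form). For any weighted
digraph `Γ` and vertices `i, j`, `W^{ij} = ε(𝔉^{i→j})`: the cofactor of the `(i,j)`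
entry of `W = I + L(Γ)` equals the total weight of the spanning diverging forests in
which `j` belongs to the tree diverging from `i`. -/
theorem matrix_forest_cofactor_digraph (n : ℕ) (ε : Fin (n + 1) → Fin (n + 1) → ℝ)
    (hdiag : ∀ a, ε a a = 0) (i j : Fin (n + 1)) :
    cofactor (1 + kirchhoff ε) i j = ∑ F ∈ divForestsFromTo i j, arcWt ε F := by
  rw [← mf_sum ε hdiag i j, ← Matrix.adjugate_apply, Matrix.adjugate_fin_succ_eq_det_submatrix]
  rfl
end

section
/- Theorem 6 (Matrix-Forest Theorem for graphs, cofactor form). For any weighted graph G on a finite vertex set V = {1,…,n} and any vertices i, j ∈ V, W^{ij} = ε(𝔉^{ij}), i.e., the cofactor of the (i,j) entry of W = I + L(G) equals the sum of the weights of those spanning rooted forests of G in which i and j belong to the same tree and that tree is rooted at i. -/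
open scoped Classical

/-- The Laplacian (Kirchhoff) matrix of a weighted graph on vertex set `α` with
symmetric edge weights `ε`: `ℓ i j = -ε i j` for `j ≠ i`, and `ℓ i i = ∑_{k ≠ i} ε i k`. -/
noncomputable def lap {α : Type*} [Fintype α] [DecidableEq α]
    (ε : α → α → ℝ) : Matrix α α ℝ :=
  Matrix.of fun i j =>
    if i = j then ∑ k ∈ Finset.univ.erase i, ε i k else - ε i j

/-- The weight of a set of (undirected) edges: the product of the edge weights. -/
noncomputable def edgeWt {α : Type*} (ε : α → α → ℝ) (hsym : ∀ a b, ε a b = ε b a)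
    (F : Finset (Sym2 α)) : ℝ :=
  ∏ e ∈ F, Sym2.lift ⟨ε, hsym⟩ e

/-- `(F, R)` is a spanning rooted forest: the edges of `F` join distinct vertices, the
spanning subgraph with edge set `F` contains no cycles, and `R` contains exactly one
vertex (the root) from each connected component. -/
def IsRootedSpanningForest {α : Type*} [Fintype α] [DecidableEq α]
    (F : Finset (Sym2 α)) (R : Finset α) : Prop :=
  (∀ e ∈ F, ¬ e.IsDiag) ∧
  (SimpleGraph.fromEdgeSet (↑F : Set (Sym2 α))).IsAcyclic ∧
  ∀ v : α, ∃! r, r ∈ R ∧ (SimpleGraph.fromEdgeSet (↑F : Set (Sym2 α))).Reachable v r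

/-- The set `𝔉` of all spanning rooted forests `(F, R)`. -/
noncomputable def rootedForests (α : Type*) [Fintype α] [DecidableEq α] :
    Finset (Finset (Sym2 α) × Finset α) :=
  Finset.univ.filter fun FR => IsRootedSpanningForest FR.1 FR.2

/-- The set `𝔉^{ij}` of spanning rooted forests in which `i` and `j` belong to the same
tree and that tree is rooted at `i`. -/
noncomputable def rootedForestsSame {α : Type*} [Fintype α] [DecidableEq α] (i j : α) :
    Finset (Finset (Sym2 α) × Finset α) :=
  Finset.univ.filter fun FR => IsRootedSpanningForest FR.1 FR.2 ∧
    (SimpleGraph.fromEdgeSet (↑FR.1 : Set (Sym2 α))).Reachable i j ∧ i ∈ FR.2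

section helpers
variable {V : Type} [Fintype V] [DecidableEq V]

/-- One step of the functional digraph `f`. -/
def fstep (f : V → Option V) (w v : V) : Prop := f v = some w

/-- `f` has no directed cycles. -/
def FAcyc (f : V → Option V) : Prop := WellFounded (fstep f)

/-- following `f` from `v` one arrives at `r`. -/
def Flows (f : V → Option V) (v r : V) : Prop :=
  Relation.ReflTransGen (fun a b => f a = some b) v r

/-- Row vectors. -/
noncomputable def frow (v : V) (o : Option V) : V → ℝ :=
  o.elim (Pi.single v 1) (fun w => Pi.single v 1 - Pi.single w 1)

/-- The matrix of a functional digraph. -/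
noncomputable def fmat (f : V → Option V) : Matrix V V ℝ :=
  Matrix.of fun v => frow v (f v)

theorem Flows.step_iff {f : V → Option V} {v w k : V} (h : f v = some w) (hk : v ≠ k) :
    Flows f v k ↔ Flows f w k := by
  constructor
  · intro hf
    rcases Relation.ReflTransGen.cases_head hf with h1 | ⟨c, hc, h2⟩
    · exact absurd h1 hk
    · rw [h] at hc
      cases hc
      exact h2
  · intro hf
    exact Relation.ReflTransGen.head h hf

theorem Flows.eq_of_none {f : V → Option V} {v k : V} (h : f v = none) (hf : Flows f v k) :
    v = k := by
  rcases Relation.ReflTransGen.cases_head hf with h1 | ⟨c, hc, h2⟩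
  · exact h1
  · rw [h] at hc
    cases hc

theorem FAcyc.exists_root {f : V → Option V} (hf : FAcyc f) (v : V) :
    ∃ r, f r = none ∧ Flows f v r := by
  induction v using hf.induction with
  | _ v ih =>
    cases h : f v with
    | none => exact ⟨v, h, Relation.ReflTransGen.refl⟩
    | some w =>
      obtain ⟨r, hr, hw⟩ := ih w h
      exact ⟨r, hr, Relation.ReflTransGen.head h hw⟩

theorem FAcyc.ne {f : V → Option V} (hf : FAcyc f) {v w : V} (h : f v = some w) : v ≠ w := by
  rintro rfl
  exact hf.irrefl.irrefl v h

theorem FAcyc.not_flows {f : V → Option V} (hf : FAcyc f) {v w : V} (h : f v = some w) :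
    ¬ Flows f w v := by
  intro h2
  have h3 : Relation.TransGen (fun a b => f a = some b) v v := Relation.TransGen.head' h h2
  have h4 : Relation.TransGen (fstep f) v v := by
    rw [← Relation.transGen_swap] 
    exact h3
  exact hf.transGen.irrefl.irrefl v h4

theorem det_fmat {f : V → Option V} (hf : FAcyc f) : (fmat f).det = 1 := by
  have : IsWellFounded V (fstep f) := ⟨hf⟩
  have hoff : ∀ v w, v ≠ w → f v ≠ some w → fmat f v w = 0 := by
    intro v w h1 h2
    cases h : f v with
    | none => simp [fmat, frow, h, Ne.symm h1]
    | some u =>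
      have : w ≠ u := by rintro rfl; exact h2 h
      simp [fmat, frow, h, Ne.symm h1, this]
  have hdg : ∀ v, fmat f v v = 1 := by
    intro v
    cases h : f v with
    | none => simp [fmat, frow, h]
    | some u =>
      have := hf.ne h
      simp [fmat, frow, h, this]
  have hbt : (fmat f).BlockTriangular
      (fun v => OrderDual.toDual (IsWellFounded.rank (fstep f) v)) := by
    intro v w hvw
    have hvw' : IsWellFounded.rank (fstep f) v < IsWellFounded.rank (fstep f) w := hvw
    apply hoff
    · rintro rfl; exact lt_irrefl _ hvw'
    · intro h
      exact lt_asymm hvw' (IsWellFounded.rank_lt_of_rel (r := fstep f) h)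
  rw [hbt.det]
  apply Finset.prod_eq_one
  intro a _
  have hone : (fmat f).toSquareBlock
      (fun v => OrderDual.toDual (IsWellFounded.rank (fstep f) v)) a = 1 := ?_
  · rw [hone, Matrix.det_one]
  ext ⟨v, hv⟩ ⟨w, hw⟩
  by_cases hvw : v = w
  · subst hvw; rw [Matrix.one_apply_eq]; exact hdg v
  · rw [Matrix.one_apply_ne (by simpa using hvw)]
    apply hoff _ _ hvw
    intro h
    have h1 := IsWellFounded.rank_lt_of_rel (r := fstep f) h
    have h2 := hv.trans hw.symm
    exact absurd (OrderDual.toDual_inj.mp h2) h1.ne'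

theorem det_update_of_flows {f : V → Option V} (i j : V) (h : Flows f j i) :
    ((fmat f).updateRow i (Pi.single j 1)).det
      = ((fmat f).updateRow i (Pi.single i 1)).det := by
  induction h using Relation.ReflTransGen.head_induction_on with
  | refl => rfl
  | @head a c hac hc ih =>
    by_cases hai : a = i
    · rw [hai]
    · rw [← ih]
      have : (Pi.single a 1 : V → ℝ) = fmat f a + Pi.single c 1 := by
        ext x; simp [fmat, frow, hac]
      rw [this, Matrix.det_updateRow_add, Matrix.det_updateRow_eq_zero hai, zero_add]

theorem det_update_of_flows_ne {f : V → Option V} (i j r : V) (h : Flows f j r)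
    (hi : f i = none) (hr : f r = none) (hri : r ≠ i) :
    ((fmat f).updateRow i (Pi.single j 1)).det = 0 := by
  induction h using Relation.ReflTransGen.head_induction_on with
  | refl =>
    have : (Pi.single r 1 : V → ℝ) = fmat f r := by
      ext x; simp [fmat, frow, hr]
    rw [this, Matrix.det_updateRow_eq_zero hri]
  | @head a c hac hc ih =>
    have hai : a ≠ i := by rintro rfl; rw [hi] at hac; cases hac
    have : (Pi.single a 1 : V → ℝ) = fmat f a + Pi.single c 1 := by
      ext x; simp [fmat, frow, hac]
    rw [this, Matrix.det_updateRow_add, Matrix.det_updateRow_eq_zero hai, zero_add, ih]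

theorem det_update_of_not_acyc {f : V → Option V} (hf : ¬ FAcyc f) (i : V) (x : V → ℝ)
    (hi : f i = none) :
    ((fmat f).updateRow i x).det = 0 := by
  unfold FAcyc at hf
  rw [wellFounded_iff_isEmpty_descending_chain, not_isEmpty_iff] at hf
  obtain ⟨s, hs⟩ := hf
  have hs' : ∀ m, f (s m) = some (s (m + 1)) := hs
  obtain ⟨a, b, hlt, hab⟩ : ∃ a b, a < b ∧ s a = s b := by
    obtain ⟨a, b, hne, hab⟩ := Finite.exists_ne_map_eq_of_infinite s
    rcases lt_or_gt_of_ne hne with h | h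
    · exact ⟨a, b, h, hab⟩
    · exact ⟨b, a, h, hab.symm⟩
  rw [← Matrix.exists_vecMul_eq_zero_iff]
  refine ⟨∑ m ∈ Finset.Ico a b, Pi.single (s m) 1, ?_, ?_⟩
  · intro h
    have h1 := congrFun h (s a)
    rw [Finset.sum_apply] at h1
    have h2 : (0 : ℝ) < ∑ m ∈ Finset.Ico a b, (Pi.single (s m) (1 : ℝ) : V → ℝ) (s a) := by
      apply Finset.sum_pos'
      · intro m _
        rw [Pi.single_apply]; split_ifs <;> norm_num
      · exact ⟨a, by simp [hlt], by simp⟩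
    simp only [Pi.zero_apply] at h1
    linarith
  · rw [Matrix.sum_vecMul]
    have : ∀ m, Matrix.vecMul (Pi.single (s m) 1) ((fmat f).updateRow i x)
        = -((Pi.single (s (m+1)) 1 : V → ℝ) - Pi.single (s m) 1) := by
      intro m
      have hmi : s m ≠ i := by
        intro h; have := hs' m; rw [h, hi] at this; cases this
      rw [Matrix.single_one_vecMul]
      ext y
      simp [Matrix.updateRow_ne hmi, fmat, frow, hs' m]
    simp only [this]
    rw [Finset.sum_neg_distrib,
      Finset.sum_Ico_sub (fun m => (Pi.single (s m) 1 : V → ℝ)) hlt.le, hab]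
    simp

theorem det_update_eq {f : V → Option V} (i j : V) (hi : f i = none) :
    ((fmat f).updateRow i (Pi.single j 1)).det = if FAcyc f ∧ Flows f j i then 1 else 0 := by
  by_cases hf : FAcyc f
  · by_cases h : Flows f j i
    · rw [if_pos ⟨hf, h⟩, det_update_of_flows i j h]
      have : (Pi.single i 1 : V → ℝ) = fmat f i := by
        ext x; simp [fmat, frow, hi]
      rw [this, Matrix.updateRow_eq_self, det_fmat hf]
    · rw [if_neg (fun h' => h h'.2)]
      obtain ⟨r, hr, hjr⟩ := hf.exists_root j
      exact det_update_of_flows_ne i j r hjr hi hr (by rintro rfl; exact h hjr)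
  · rw [if_neg (fun h' => hf h'.1), det_update_of_not_acyc hf i _ hi]

/-- weight of a functional digraph -/
noncomputable def fwt (ε : V → V → ℝ) (f : V → Option V) : ℝ :=
  ∏ v, (f v).elim 1 (ε v)

theorem lap_row (ε : V → V → ℝ) (v : V) :
    (1 + lap ε) v = ∑ o : Option V, (o.elim 1 (ε v) : ℝ) • frow v o := by
  ext x
  rw [Fintype.sum_option]
  simp only [lap, frow, Matrix.add_apply, Option.elim, Pi.add_apply, Finset.sum_apply,
    Pi.smul_apply, Pi.sub_apply, smul_eq_mul, Matrix.of_apply, one_mul, mul_sub,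
    Finset.sum_sub_distrib]
  by_cases h : v = x
  · subst h
    simp [Pi.single_apply, Finset.sum_erase_eq_sub]
  · simp [Pi.single_apply, h, Ne.symm h]

theorem det_expand (ε : V → V → ℝ) (i j : V) :
    ((1 + lap ε).updateRow i (Pi.single j 1)).det
      = ∑ f : V → Option V, if (FAcyc f ∧ Flows f j i ∧ f i = none) then fwt ε f else 0 := by
  let c : V → Option V → ℝ := fun v o => if v = i then o.elim 1 (fun _ => 0) else o.elim 1 (ε v)
  let g : V → Option V → (V → ℝ) := fun v o => if v = i then Pi.single j 1 else frow v o
  have h1 : (1 + lap ε).updateRow i (Pi.single j 1) = fun v => ∑ o : Option V, c v o • g v o := by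
    funext v
    by_cases h : v = i
    · subst h
      simp [c, g]
    · have h2 := lap_row ε v
      simp only [c, g, h, if_false, ← h2]
      ext x
      simp [Matrix.updateRow_ne h]
  rw [h1]
  change Matrix.detRowAlternating.toMultilinearMap _ = _
  rw [MultilinearMap.map_sum]
  apply Finset.sum_congr rfl
  intro f _
  rw [MultilinearMap.map_smul_univ (c := fun v => c v (f v)) (m := fun v => g v (f v))]
  cases hi : f i with
  | some w =>
    rw [Finset.prod_eq_zero (Finset.mem_univ i) (by simp [c, hi])]
    simp
  | none =>
    have h3 : (fun v => g v (f v)) = (fmat f).updateRow i (Pi.single j 1) := by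
      funext v
      by_cases h : v = i
      · subst h; simp [g]
      · ext x; simp [g, h, Matrix.updateRow_ne h, fmat]
    have h4 : ∏ v, c v (f v) = fwt ε f := by
      apply Finset.prod_congr rfl
      intro v _
      by_cases h : v = i
      · subst h; simp [c, hi]
      · simp [c, h]
    rw [h4, h3]
    change _ • Matrix.det _ = _
    rw [det_update_eq i j hi]
    simp

end helpers
section helpers2
variable {V : Type} [Fintype V] [DecidableEq V]

/-- root set -/
noncomputable def froots (f : V → Option V) : Finset V := Finset.univ.filter fun v => f v = none

/-- edge attached to a vertex -/
def fedge (f : V → Option V) (v : V) : Sym2 V := (f v).elim s(v, v) (fun w => s(v, w))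

/-- edge set -/
noncomputable def fedges (f : V → Option V) : Finset (Sym2 V) :=
  (Finset.univ.filter fun v => f v ≠ none).image (fedge f)

/-- the undirected graph -/
abbrev fgraph (F : Finset (Sym2 V)) : SimpleGraph V :=
  SimpleGraph.fromEdgeSet (↑F : Set (Sym2 V))

theorem mem_fedges {f : V → Option V} {e : Sym2 V} :
    e ∈ fedges f ↔ ∃ v w, f v = some w ∧ e = s(v, w) := by
  simp only [fedges, Finset.mem_image, Finset.mem_filter, Finset.mem_univ, true_and]
  constructor
  · rintro ⟨v, hv, rfl⟩
    obtain ⟨w, hw⟩ := Option.ne_none_iff_exists'.mp hv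
    exact ⟨v, w, hw, by simp [fedge, hw]⟩
  · rintro ⟨v, w, h, rfl⟩
    exact ⟨v, by simp [h], by simp [fedge, h]⟩

theorem mk_mem_fedges {f : V → Option V} {a b : V} :
    s(a, b) ∈ fedges f ↔ f a = some b ∨ f b = some a := by
  rw [mem_fedges]
  constructor
  · rintro ⟨v, w, h, he⟩
    rcases Sym2.eq_iff.mp he with ⟨rfl, rfl⟩ | ⟨rfl, rfl⟩
    · exact Or.inl h
    · exact Or.inr h
  · rintro (h | h)
    · exact ⟨a, b, h, rfl⟩
    · exact ⟨b, a, h, Sym2.eq_swap⟩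

theorem reach_pres {G : SimpleGraph V} {P : V → Prop} (h : ∀ a b, G.Adj a b → P a → P b)
    {a b : V} (hr : G.Reachable a b) (ha : P a) : P b := by
  obtain ⟨p⟩ := hr
  induction p with
  | nil => exact ha
  | cons hadj p ih => exact ih (h _ _ hadj ha)

theorem FAcyc.fgraph_adj {f : V → Option V} (hf : FAcyc f) {a b : V} :
    (fgraph (fedges f)).Adj a b ↔ f a = some b ∨ f b = some a := by
  rw [SimpleGraph.fromEdgeSet_adj, Finset.mem_coe, mk_mem_fedges]
  constructor
  · exact fun h => h.1
  · intro h
    refine ⟨h, ?_⟩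
    rcases h with h | h
    · exact hf.ne h
    · exact (hf.ne h).symm

theorem FAcyc.reach_of_flows {f : V → Option V} (hf : FAcyc f) {a b : V} (h : Flows f a b) :
    (fgraph (fedges f)).Reachable a b := by
  induction h using Relation.ReflTransGen.head_induction_on with
  | refl => exact SimpleGraph.Reachable.refl _
  | head hac _ ih =>
    exact (SimpleGraph.Adj.reachable (hf.fgraph_adj.mpr (Or.inl hac))).trans ih

theorem FAcyc.flows_of_reach {f : V → Option V} (hf : FAcyc f) {a r : V} (hr : f r = none)
    (h : (fgraph (fedges f)).Reachable a r) : Flows f a r := by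
  refine reach_pres (P := fun v => Flows f v r) ?_ h.symm Relation.ReflTransGen.refl
  intro a b hab ha
  have key : ∀ v w, f v = some w → v ≠ r := by
    rintro v w hvw rfl; rw [hr] at hvw; cases hvw
  rcases hf.fgraph_adj.mp hab with h | h
  · exact (Flows.step_iff h (key _ _ h)).mp ha
  · exact (Flows.step_iff h (key _ _ h)).mpr ha

theorem FAcyc.isForest {f : V → Option V} (hf : FAcyc f) :
    IsRootedSpanningForest (fedges f) (froots f) := by
  refine ⟨?_, ?_, ?_⟩
  · intro e he
    obtain ⟨v, w, h, rfl⟩ := mem_fedges.mp he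
    simpa using hf.ne h
  · have main : ∀ v w, f v = some w → (fgraph (fedges f)).IsBridge s(v, w) := by
      intro v w h
      rw [SimpleGraph.isBridge_iff]
      intro hr
      refine hf.not_flows h
        (reach_pres (P := fun u => Flows f u v) ?_ hr Relation.ReflTransGen.refl)
      intro a b hab ha
      rw [SimpleGraph.deleteEdges_adj] at hab
      obtain ⟨hab, hne⟩ := hab
      rcases hf.fgraph_adj.mp hab with h1 | h1
      · have : a ≠ v := by
          rintro rfl
          rw [h] at h1; cases h1
          exact hne rfl
        exact (Flows.step_iff h1 this).mp ha
      · have : b ≠ v := by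
          rintro rfl
          rw [h] at h1; cases h1
          exact hne Sym2.eq_swap
        exact (Flows.step_iff h1 this).mpr ha
    rw [SimpleGraph.isAcyclic_iff_forall_adj_isBridge]
    intro v w hvw
    rcases hf.fgraph_adj.mp hvw with h | h
    · exact main v w h
    · rw [Sym2.eq_swap]; exact main w v h
  · intro v
    obtain ⟨r, hr, hvr⟩ := hf.exists_root v
    refine ⟨r, ⟨by simp [froots, hr], hf.reach_of_flows hvr⟩, ?_⟩
    rintro r' ⟨hr', hvr'⟩
    have hr'' : f r' = none := by simpa [froots] using hr'
    have := hf.flows_of_reach hr (hvr'.symm.trans (hf.reach_of_flows hvr))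
    exact Flows.eq_of_none hr'' this

theorem FAcyc.edgeWt_eq {f : V → Option V} (hf : FAcyc f) (ε : V → V → ℝ)
    (hsym : ∀ a b, ε a b = ε b a) : edgeWt ε hsym (fedges f) = fwt ε f := by
  unfold edgeWt fedges fwt
  rw [Finset.prod_image, Finset.prod_filter]
  · apply Finset.prod_congr rfl
    intro v _
    cases h : f v with
    | none => simp
    | some w => simp [fedge, h]
  · intro a ha b hb hab
    have ha' : f a ≠ none := by simpa using ha
    have hb' : f b ≠ none := by simpa using hb
    obtain ⟨a', ha'⟩ := Option.ne_none_iff_exists'.mp ha'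
    obtain ⟨b', hb'⟩ := Option.ne_none_iff_exists'.mp hb'
    simp only [fedge, ha', hb', Option.elim] at hab
    rcases Sym2.eq_iff.mp hab with ⟨h, _⟩ | ⟨h1, h2⟩
    · exact h
    · subst h1 h2
      exact (hf.not_flows ha' (Relation.ReflTransGen.single hb')).elim

theorem FAcyc.inj {f g : V → Option V} (hf : FAcyc f)
    (hF : fedges f = fedges g) (hR : froots f = froots g) : f = g := by
  have hn : ∀ v, f v = none ↔ g v = none := by
    intro v
    have : v ∈ froots f ↔ v ∈ froots g := by rw [hR]
    simpa [froots] using this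
  funext v
  induction v using hf.induction with
  | _ v ih =>
    cases h : f v with
    | none => exact ((hn v).mp h).symm
    | some w =>
      have h1 : s(v, w) ∈ fedges g := by
        rw [← hF, mk_mem_fedges]; exact Or.inl h
      rcases mk_mem_fedges.mp h1 with h2 | h2
      · exact h2.symm
      · rw [← ih w h] at h2
        exact (hf.not_flows h (Relation.ReflTransGen.single h2)).elim

theorem exists_fun {F : Finset (Sym2 V)} {R : Finset V} (h : IsRootedSpanningForest F R) :
    ∃ f : V → Option V, FAcyc f ∧ fedges f = F ∧ froots f = R := by
  obtain ⟨hd, hac, hroot⟩ := h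
  choose ρ hρ hu using hroot
  have hρR : ∀ v, ρ v ∈ R := fun v => (hρ v).1
  have hρr : ∀ v, (fgraph F).Reachable v (ρ v) := fun v => (hρ v).2
  have hself : ∀ v ∈ R, ρ v = v := fun v hv =>
    (hu v v ⟨hv, SimpleGraph.Reachable.refl _⟩).symm
  have hadj : ∀ v w, (fgraph F).Adj v w → ρ v = ρ w := fun v w hvw =>
    hu w (ρ v) ⟨hρR v, hvw.symm.reachable.trans (hρr v)⟩
  let d : V → ℕ := fun v => (fgraph F).dist v (ρ v)
  have hnext : ∀ v, ∃ o : Option V, (v ∈ R → o = none) ∧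
      (v ∉ R → ∃ w, o = some w ∧ (fgraph F).Adj v w ∧ d w < d v) := by
    intro v
    by_cases hv : v ∈ R
    · exact ⟨none, fun _ => rfl, fun h => absurd hv h⟩
    · obtain ⟨p, hp⟩ := (hρr v).exists_walk_length_eq_dist
      generalize hx : ρ v = x at p hp
      cases p with
      | nil => exact absurd (hx ▸ hρR v) hv
      | @cons _ w _ hvw q =>
        refine ⟨some w, fun h => absurd h hv, fun _ => ⟨w, rfl, hvw, ?_⟩⟩
        have h1 : ρ w = x := by rw [← hadj v w hvw, hx]
        have h2 := SimpleGraph.dist_le q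
        simp only [d, h1, hx]
        rw [SimpleGraph.Walk.length_cons] at hp
        omega
  choose f hf0 hf1 using hnext
  have hstep : ∀ v w, f v = some w → v ∉ R ∧ (fgraph F).Adj v w ∧ d w < d v := by
    intro v w h
    have hv : v ∉ R := by
      intro hv; rw [hf0 v hv] at h; cases h
    obtain ⟨w', h1, h2, h3⟩ := hf1 v hv
    rw [h] at h1; cases h1
    exact ⟨hv, h2, h3⟩
  have hacyc : FAcyc f := by
    refine Subrelation.wf (r := fun a b => d a < d b) ?_ (measure d).wf
    intro a b hab
    exact (hstep b a hab).2.2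
  have hroots : froots f = R := by
    ext v
    simp only [froots, Finset.mem_filter, Finset.mem_univ, true_and]
    constructor
    · intro h
      by_contra hv
      obtain ⟨w, h1, _⟩ := hf1 v hv
      rw [h] at h1; cases h1
    · exact hf0 v
  have hsub : ∀ v w, f v = some w → s(v, w) ∈ F := by
    intro v w h
    have := (hstep v w h).2.1
    rw [SimpleGraph.fromEdgeSet_adj] at this
    exact this.1
  refine ⟨f, hacyc, ?_, hroots⟩
  ext e
  constructor
  · intro he
    obtain ⟨v, w, h, rfl⟩ := mem_fedges.mp he
    exact hsub v w h
  · intro he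
    induction e using Sym2.ind with
    | _ a b =>
      by_contra hne
      have hab : (fgraph F).Adj a b := by
        rw [SimpleGraph.fromEdgeSet_adj]
        exact ⟨he, by simpa using hd _ he⟩
      have hbr := (SimpleGraph.isAcyclic_iff_forall_adj_isBridge.mp hac) hab
      rw [SimpleGraph.isBridge_iff] at hbr
      apply hbr
      have hle : fgraph (fedges f) ≤ (fgraph F).deleteEdges {s(a, b)} := by
        intro x y hxy
        rw [SimpleGraph.deleteEdges_adj]
        have hmem : s(x, y) ∈ fedges f := by
          rw [SimpleGraph.fromEdgeSet_adj] at hxy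
          exact hxy.1
        refine ⟨?_, ?_⟩
        · rcases hacyc.fgraph_adj.mp hxy with h | h
          · exact (hstep _ _ h).2.1
          · exact (hstep _ _ h).2.1.symm
        · intro h
          rw [Set.mem_singleton_iff] at h
          exact hne (h ▸ hmem)
      have hfr : ∀ v, (fgraph (fedges f)).Reachable v (ρ v) := by
        intro v
        obtain ⟨r, hr, hvr⟩ := hacyc.exists_root v
        have h1 := hacyc.reach_of_flows hvr
        have h2 : (fgraph F).Reachable v r :=
          h1.mono (hle.trans (SimpleGraph.deleteEdges_le _))
        have h3 : r ∈ R := by rw [← hroots]; simp [froots, hr]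
        rw [← hu v r ⟨h3, h2⟩]
        exact h1
      have h5 : (fgraph (fedges f)).Reachable a b := by
        refine (hfr a).trans ?_
        rw [hadj a b hab]
        exact (hfr b).symm
      exact h5.mono hle

end helpers2

/-- **Theorem 6** (Matrix-Forest Theorem for graphs, cofactor form). For any weighted
graph `G` and vertices `i, j`, `W^{ij} = ε(𝔉^{ij})`: the cofactor of the `(i,j)` entry
of `W = I + L(G)` equals the total weight of the spanning rooted forests in which `i`
and `j` belong to the same tree and that tree is rooted at `i`. -/
theorem matrix_forest_cofactor_graph (n : ℕ) (ε : Fin (n + 1) → Fin (n + 1) → ℝ)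
    (hsym : ∀ a b, ε a b = ε b a) (hdiag : ∀ a, ε a a = 0) (i j : Fin (n + 1)) :
    cofactor (1 + lap ε) i j = ∑ FR ∈ rootedForestsSame i j, edgeWt ε hsym FR.1 := by
  have h0 : cofactor (1 + lap ε) i j = ((1 + lap ε).updateRow i (Pi.single j 1)).det := by
    rw [← Matrix.adjugate_apply, Matrix.adjugate_fin_succ_eq_det_submatrix]
    rfl
  rw [h0, det_expand, ← Finset.sum_filter]
  refine Finset.sum_bij (fun f _ => (fedges f, froots f)) ?_ ?_ ?_ ?_
  · intro f hf
    obtain ⟨h1, h2, h3⟩ := (Finset.mem_filter.mp hf).2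
    refine Finset.mem_filter.mpr ⟨Finset.mem_univ _, h1.isForest, ?_, ?_⟩
    · exact (h1.reach_of_flows h2).symm
    · simp [froots, h3]
  · intro f hf g hg hfg
    obtain ⟨h1, h2, h3⟩ := (Finset.mem_filter.mp hf).2
    exact h1.inj (congrArg Prod.fst hfg) (congrArg Prod.snd hfg)
  · rintro ⟨F, R⟩ hFR
    obtain ⟨h1, h2, h3⟩ := (Finset.mem_filter.mp hFR).2
    obtain ⟨f, hf, rfl, rfl⟩ := exists_fun h1
    have hi : f i = none := by simpa [froots] using h3
    exact ⟨f, Finset.mem_filter.mpr ⟨Finset.mem_univ _, hf, hf.flows_of_reach hi h2.symm, hi⟩, rfl⟩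
  · intro f hf
    obtain ⟨h1, h2, h3⟩ := (Finset.mem_filter.mp hf).2
    exact (h1.edgeWt_eq ε hsym).symm
end

section
/- Theorem 7, part 2 (relative forest-accessibilities of a graph). For any weighted graph G on a finite vertex set V = {1,…,n}, if the matrix W = I + L(G) is invertible with inverse Q = (q_{ij}), then for all i, j ∈ V, q_{ij} = ε(𝔉^{ji}) / ε(𝔉). -/
open scoped Classical

/-! ## Parent functions -/

/-- A parent function is acyclic if it decreases some rank. -/
def PAcyc {V : Type*} (f : V → Option V) : Prop :=
  ∃ d : V → ℕ, ∀ v w, f v = some w → d w < d v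

/-- `w` is an ancestor of `v`. -/
def PReach {V : Type*} (f : V → Option V) : V → V → Prop :=
  Relation.ReflTransGen (fun v w => f v = some w)

/-- The matrix of a parent function. -/
noncomputable def PM {V : Type*} [DecidableEq V] (f : V → Option V) : Matrix V V ℝ :=
  Matrix.of fun v w => (if v = w then 1 else 0) - (if f v = some w then 1 else 0)

/-- Weight of a parent choice. -/
noncomputable def pw {V : Type*} (ε : V → V → ℝ) (v : V) : Option V → ℝ
  | none => 1
  | some w => ε v w

theorem exists_cycle_of_not_PAcyc {V : Type*} [Fintype V] [DecidableEq V] (f : V → Option V)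
    (h : ¬ PAcyc f) : ∃ C : Set V, C.Nonempty ∧
      (∀ v ∈ C, ∃ w ∈ C, f v = some w) ∧ (∀ w ∈ C, ∃! v, v ∈ C ∧ f v = some w) := by
  classical
  set g : Option V → Option V := fun o => o.bind f with hg
  have gs : ∀ v, g (some v) = f v := fun v => rfl
  have gn : g none = none := rfl
  have gni : ∀ k, g^[k] none = none := fun k => Function.iterate_fixed gn k
  have hb := Function.bijOn_periodicPts g
  refine ⟨{v | some v ∈ Function.periodicPts g}, ?_, ?_, ?_⟩
  · by_contra hC
    rw [Set.not_nonempty_iff_eq_empty, Set.eq_empty_iff_forall_notMem] at hC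
    simp only [Set.mem_ofPred_eq] at hC
    apply h
    have hk : ∀ v, ∃ k, g^[k] (some v) = none := by
      intro v
      obtain ⟨a, b, hab, he⟩ := Finite.exists_ne_map_eq_of_infinite (fun k : ℕ => g^[k] (some v))
      wlog hlt : a < b generalizing a b
      · exact this b a hab.symm he.symm (by omega)
      have hp : g^[a] (some v) ∈ Function.periodicPts g := by
        refine ⟨b - a, by omega, ?_⟩
        change g^[b-a] _ = _
        rw [← Function.iterate_add_apply, show b - a + a = b by omega]
        exact he.symm
      refine ⟨a, ?_⟩
      cases hx : g^[a] (some v) with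
      | none => rfl
      | some x => rw [hx] at hp; exact absurd hp (hC x)
    refine ⟨fun v => Nat.find (hk v), ?_⟩
    intro v w hvw
    have h1 := Nat.find_spec (hk v)
    rcases hm : Nat.find (hk v) with _ | m
    · rw [hm] at h1; simp at h1
    · rw [hm, Function.iterate_succ_apply, gs, hvw] at h1
      have h2 := Nat.find_min' (hk w) h1
      change Nat.find (hk w) < Nat.find (hk v)
      omega
  · intro v hv
    have h1 := hb.mapsTo hv
    rw [gs] at h1
    cases hx : f v with
    | some w => rw [hx] at h1; exact ⟨w, h1, rfl⟩
    | none =>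
      obtain ⟨k, hk0, hk⟩ := hv
      obtain ⟨m, rfl⟩ : ∃ m, k = m + 1 := ⟨k - 1, by omega⟩
      change g^[m+1] _ = _ at hk
      rw [Function.iterate_succ_apply, gs, hx, gni] at hk
      simp at hk
  · intro w hw
    obtain ⟨o, ho, how⟩ := hb.surjOn hw
    cases o with
    | none => simp [gn] at how
    | some v =>
      refine ⟨v, ⟨ho, how⟩, ?_⟩
      rintro v' ⟨hv', hf⟩
      have := hb.injOn hv' ho (by rw [gs, hf, how])
      exact Option.some.inj this

theorem cycle_vecMul {V : Type*} [Fintype V] [DecidableEq V] (f : V → Option V) (C : Set V)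
    (h1 : ∀ v ∈ C, ∃ w ∈ C, f v = some w) (h2 : ∀ w ∈ C, ∃! v, v ∈ C ∧ f v = some w) (w : V) :
    ∑ v, (if v ∈ C then (1:ℝ) else 0) * PM f v w = 0 := by
  simp only [PM, Matrix.of_apply, mul_sub, Finset.sum_sub_distrib]
  have e1 : ∑ v, (if v ∈ C then (1:ℝ) else 0) * (if v = w then 1 else 0)
      = if w ∈ C then 1 else 0 := by simp
  have e2 : ∑ v, (if v ∈ C then (1:ℝ) else 0) * (if f v = some w then 1 else 0)
      = if w ∈ C then 1 else 0 := by
    by_cases hw : w ∈ C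
    · obtain ⟨v, ⟨hv, hf⟩, hu⟩ := h2 w hw
      rw [Finset.sum_eq_single v]
      · simp [hv, hf, hw]
      · intro b _ hb
        by_cases hbC : b ∈ C
        · by_cases hfb : f b = some w
          · exact absurd (hu b ⟨hbC, hfb⟩) hb
          · simp [hfb]
        · simp [hbC]
      · simp
    · rw [if_neg hw]
      apply Finset.sum_eq_zero
      intro v _
      by_cases hv : v ∈ C
      · obtain ⟨x, hx, hfx⟩ := h1 v hv
        have : f v ≠ some w := by
          rw [hfx]; intro h; exact hw (Option.some.inj h ▸ hx)
        simp [this]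
      · simp [hv]
  rw [e1, e2, sub_self]

theorem det_PM_acyc {V : Type*} [Fintype V] [DecidableEq V] (f : V → Option V)
    (h : PAcyc f) : (PM f).det = 1 := by
  obtain ⟨d, hd⟩ := h
  have hb : (PM f).BlockTriangular (fun v => OrderDual.toDual (d v)) := by
    intro v w hvw
    have hvw' : d v < d w := hvw
    have h1 : v ≠ w := by rintro rfl; omega
    have h2 : f v ≠ some w := fun h => by have := hd v w h; omega
    simp [PM, h1, h2]
  rw [hb.det]
  apply Finset.prod_eq_one
  intro k _
  rw [← Matrix.det_one (n := {a // (fun v => OrderDual.toDual (d v)) a = k})]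
  congr 1
  ext ⟨v, hv⟩ ⟨w, hw⟩
  have h2 : f v ≠ some w := fun h => by
    have h3 := hd v w h
    have : d v = d w := by
      have := hv.trans hw.symm
      exact OrderDual.toDual.injective this
    omega
  simp [PM, Matrix.toSquareBlock, Matrix.toSquareBlockProp, Matrix.one_apply, h2]

theorem det_PM {V : Type*} [Fintype V] [DecidableEq V] (f : V → Option V) :
    (PM f).det = if PAcyc f then 1 else 0 := by
  split_ifs with h
  · exact det_PM_acyc f h
  · obtain ⟨C, ⟨c, hc⟩, h1, h2⟩ := exists_cycle_of_not_PAcyc f h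
    apply Matrix.exists_vecMul_eq_zero_iff.1
    refine ⟨fun v => if v ∈ C then 1 else 0, ?_, ?_⟩
    · intro h0
      have := congrFun h0 c
      simp [hc] at this
    · ext w
      exact cycle_vecMul f C h1 h2 w

theorem PReach_iff {V : Type*} (f : V → Option V) (v j : V) :
    PReach f v j ↔ v = j ∨ ∃ w, f v = some w ∧ PReach f w j :=
  Relation.ReflTransGen.cases_head_iff

theorem PReach_rank {V : Type*} (f : V → Option V) (d : V → ℕ)
    (hd : ∀ v w, f v = some w → d w < d v) {v w : V} (h : PReach f v w) : d w ≤ d v := by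
  induction h with
  | refl => exact le_rfl
  | tail _ h ih => exact (hd _ _ h).le.trans ih

theorem adj_PM {V : Type*} [Fintype V] [DecidableEq V] (f : V → Option V) (i j : V)
    (hj : f j = none) :
    ((PM f).updateRow j (Pi.single i 1)).det = if PAcyc f ∧ PReach f i j then 1 else 0 := by
  by_cases h : PAcyc f
  · rw [← Matrix.adjugate_apply]
    have hP : PM f * (Matrix.of fun v w => if PReach f v w then (1:ℝ) else 0) = 1 := by
      ext v w
      simp only [Matrix.mul_apply, PM, Matrix.of_apply, sub_mul, Finset.sum_sub_distrib]
      obtain ⟨d, hd⟩ := h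
      have hs : ∀ (x : V) (g : V → ℝ), ∑ y, (if x = y then (1:ℝ) else 0) * g y = g x := by
        intro x g; simp
      rw [Matrix.one_apply, hs]
      cases hv : f v with
      | none =>
        have : PReach f v w ↔ v = w := by rw [PReach_iff]; simp [hv]
        simp [this]
      | some u =>
        simp only [Option.some.injEq]
        rw [hs]
        have h3 : PReach f v w ↔ v = w ∨ PReach f u w := by rw [PReach_iff]; simp [hv]
        have h4 : v = w → ¬ PReach f u w := by
          rintro rfl hr
          have := PReach_rank f d hd hr
          have := hd _ _ hv
          omega
        by_cases hvw : v = w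
        · have := h4 hvw
          subst hvw
          simp [h3, this]
        · simp [h3, hvw]
    have : (PM f).adjugate = Matrix.of fun v w => if PReach f v w then (1:ℝ) else 0 := by
      have h5 := Matrix.adjugate_mul (PM f)
      rw [det_PM_acyc f h, one_smul] at h5
      calc (PM f).adjugate = (PM f).adjugate * (PM f * _) := by rw [hP, mul_one]
        _ = _ := by rw [← mul_assoc, h5, one_mul]
    rw [this]
    simp [h]
  · rw [if_neg (fun hh => h hh.1)]
    obtain ⟨C, ⟨c, hc⟩, h1, h2⟩ := exists_cycle_of_not_PAcyc f h
    have hjC : j ∉ C := fun hjC => by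
      obtain ⟨w, _, hw⟩ := h1 j hjC
      simp [hj] at hw
    apply Matrix.exists_vecMul_eq_zero_iff.1
    refine ⟨fun v => if v ∈ C then 1 else 0, ?_, ?_⟩
    · intro h0
      have := congrFun h0 c
      simp [hc] at this
    · ext w
      refine Eq.trans ?_ (cycle_vecMul f C h1 h2 w)
      apply Finset.sum_congr rfl
      intro v _
      by_cases hv : v = j
      · subst hv; simp [hjC]
      · simp [Matrix.updateRow_ne hv]

theorem det_expand_s7 {V O : Type*} [Fintype V] [DecidableEq V] [Fintype O]
    (w : V → O → ℝ) (r : V → O → V → ℝ) :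
    (Matrix.of fun v => ∑ o, w v o • r v o).det
      = ∑ f : V → O, (∏ v, w v (f v)) * (Matrix.of fun v => r v (f v)).det := by
  classical
  have := (Matrix.detRowAlternating (R := ℝ) (n := V)).toMultilinearMap.map_sum
    (fun v o => w v o • r v o)
  refine this.trans ?_
  apply Finset.sum_congr rfl
  intro f _
  rw [MultilinearMap.map_smul_univ]
  rfl

theorem row_eq {V : Type*} [Fintype V] [DecidableEq V] (ε : V → V → ℝ) (v : V) :
    (1 + lap ε) v = ∑ o : Option V, pw ε v o •
      (fun w => (if v = w then (1:ℝ) else 0) - (if o = some w then 1 else 0)) := by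
  ext w
  rw [Fintype.sum_option]
  simp only [pw, Pi.add_apply, Finset.sum_apply, Pi.smul_apply, smul_eq_mul, Matrix.add_apply,
    mul_sub, Finset.sum_sub_distrib, lap, Matrix.of_apply, Matrix.one_apply]
  by_cases h : v = w
  · subst h
    have := Finset.add_sum_erase Finset.univ (fun k => ε v k) (Finset.mem_univ v)
    simp only [← this]
    simp
    try ring
  · simp [h]

theorem det_W {V : Type*} [Fintype V] [DecidableEq V] (ε : V → V → ℝ) :
    (1 + lap ε).det = ∑ f : V → Option V with PAcyc f, ∏ v, pw ε v (f v) := by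
  have h0 : (1 + lap ε) = Matrix.of fun v => ∑ o : Option V, pw ε v o •
      (fun w => (if v = w then (1:ℝ) else 0) - (if o = some w then 1 else 0)) := by
    ext v w
    exact congrFun (row_eq ε v) w
  rw [h0, det_expand_s7 (pw ε)
    (fun v o w => (if v = w then (1:ℝ) else 0) - (if o = some w then 1 else 0)),
    Finset.sum_filter]
  apply Finset.sum_congr rfl
  intro f _
  have := det_PM f
  unfold PM at this
  rw [this]
  simp

theorem adj_W {V : Type*} [Fintype V] [DecidableEq V] (ε : V → V → ℝ) (i j : V) :
    (1 + lap ε).adjugate i j =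
      ∑ f : V → Option V with PAcyc f ∧ f j = none ∧ PReach f i j, ∏ v, pw ε v (f v) := by
  rw [Matrix.adjugate_apply]
  set w' : V → Option V → ℝ := fun v o => if v = j then (if o = none then 1 else 0) else pw ε v o
    with hw'
  set r' : V → Option V → V → ℝ := fun v o => if v = j then Pi.single i 1 else
      (fun w => (if v = w then (1:ℝ) else 0) - (if o = some w then 1 else 0)) with hr'
  have h0 : (1 + lap ε).updateRow j (Pi.single i 1) =
      Matrix.of fun v => ∑ o : Option V, w' v o • r' v o := by
    ext v w
    by_cases hv : v = j
    · subst hv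
      simp [hw', hr', Fintype.sum_option]
    · rw [Matrix.updateRow_ne hv]
      refine (congrFun (row_eq ε v) w).trans ?_
      rw [Matrix.of_apply]
      refine congrFun (Finset.sum_congr rfl fun o _ => ?_) w
      simp only [hw', hr', if_neg hv]
  rw [h0, det_expand_s7, Finset.sum_filter]
  apply Finset.sum_congr rfl
  intro f _
  by_cases hj : f j = none
  · have h1 : (Matrix.of fun v => r' v (f v)) = (PM f).updateRow j (Pi.single i 1) := by
      ext v w
      by_cases hv : v = j
      · subst hv
        simp [hr']
      · rw [Matrix.updateRow_ne hv]
        simp [hr', hv, PM]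
    have h2 : ∏ v, w' v (f v) = ∏ v, pw ε v (f v) := by
      apply Finset.prod_congr rfl
      intro v _
      by_cases hv : v = j
      · subst hv
        simp [hw', hj, pw]
      · simp [hw', hv]
    rw [h1, h2, adj_PM f i j hj]
    simp [hj]
  · rw [if_neg (fun h => hj h.2.1), Finset.prod_eq_zero (Finset.mem_univ j), zero_mul]
    simp [hj, hw', if_true]



/-- Edge set of a parent function. -/
noncomputable def pF {V : Type*} [Fintype V] [DecidableEq V] (f : V → Option V) :
    Finset (Sym2 V) :=
  Finset.univ.filter fun e => ∃ v w, f v = some w ∧ s(v, w) = e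

/-- Root set of a parent function. -/
noncomputable def pR {V : Type*} [Fintype V] [DecidableEq V] (f : V → Option V) :
    Finset V :=
  Finset.univ.filter fun v => f v = none

theorem mem_pF {V : Type*} [Fintype V] [DecidableEq V] (f : V → Option V) (a b : V) :
    s(a, b) ∈ pF f ↔ f a = some b ∨ f b = some a := by
  simp only [pF, Finset.mem_filter, Finset.mem_univ, true_and, Sym2.eq_iff]
  constructor
  · rintro ⟨v, w, h, ⟨rfl, rfl⟩ | ⟨rfl, rfl⟩⟩
    · exact Or.inl h
    · exact Or.inr h
  · rintro (h | h)
    · exact ⟨a, b, h, Or.inl ⟨rfl, rfl⟩⟩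
    · exact ⟨b, a, h, Or.inr ⟨rfl, rfl⟩⟩

theorem PAcyc.no_two {V : Type*} {f : V → Option V} (h : PAcyc f) {a b : V}
    (h1 : f a = some b) (h2 : f b = some a) : False := by
  obtain ⟨d, hd⟩ := h
  have := hd _ _ h1
  have := hd _ _ h2
  omega

theorem PAcyc.no_loop {V : Type*} {f : V → Option V} (h : PAcyc f) {a : V}
    (h1 : f a = some a) : False := h.no_two h1 h1

theorem edgeWt_pF {V : Type*} [Fintype V] [DecidableEq V] (ε : V → V → ℝ)
    (hsym : ∀ a b, ε a b = ε b a) (f : V → Option V) (h : PAcyc f) :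
    edgeWt ε hsym (pF f) = ∏ v, pw ε v (f v) := by
  unfold edgeWt
  rw [← Finset.prod_filter_mul_prod_filter_not Finset.univ (fun v => f v = none)]
  rw [Finset.prod_eq_one (s := Finset.univ.filter fun v => f v = none), one_mul]
  swap
  · intro v hv
    rw [(Finset.mem_filter.1 hv).2]; rfl
  symm
  refine Finset.prod_bij (fun v _ => s(v, (f v).getD v)) ?_ ?_ ?_ ?_
  · intro v hv
    obtain ⟨w, hw⟩ := Option.ne_none_iff_exists'.1 (Finset.mem_filter.1 hv).2
    rw [mem_pF]; simp [hw]
  · intro v hv u hu huv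
    obtain ⟨w, hw⟩ := Option.ne_none_iff_exists'.1 (Finset.mem_filter.1 hv).2
    obtain ⟨x, hx⟩ := Option.ne_none_iff_exists'.1 (Finset.mem_filter.1 hu).2
    simp only [hw, hx, Option.getD_some, Sym2.eq_iff] at huv
    rcases huv with ⟨h1, _⟩ | ⟨h1, h2⟩
    · exact h1
    · subst h1 h2
      exact (h.no_two hw hx).elim
  · intro e he
    obtain ⟨v, w, hv, rfl⟩ := (Finset.mem_filter.1 he).2
    exact ⟨v, by simp [hv], by simp [hv]⟩
  · intro v hv
    obtain ⟨w, hw⟩ := Option.ne_none_iff_exists'.1 (Finset.mem_filter.1 hv).2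
    simp [hw, pw]

/-- The graph of a finset of edges. -/
abbrev gr {V : Type*} (F : Finset (Sym2 V)) : SimpleGraph V :=
  SimpleGraph.fromEdgeSet (↑F : Set (Sym2 V))

theorem gr_adj_pF {V : Type*} [Fintype V] [DecidableEq V] (f : V → Option V) (h : PAcyc f)
    (a b : V) : (gr (pF f)).Adj a b ↔ f a = some b ∨ f b = some a := by
  rw [SimpleGraph.fromEdgeSet_adj, Finset.mem_coe, mem_pF]
  constructor
  · exact fun h => h.1
  · refine fun h1 => ⟨h1, ?_⟩
    rintro rfl
    exact h.no_loop (h1.elim id id)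

theorem PReach.reachable {V : Type*} [Fintype V] [DecidableEq V] {f : V → Option V} (h : PAcyc f)
    {a b : V} (hab : PReach f a b) : (gr (pF f)).Reachable a b := by
  induction hab with
  | refl => exact SimpleGraph.Reachable.refl _
  | tail _ h1 ih => exact ih.trans ((gr_adj_pF f h _ _).2 (Or.inl h1)).reachable

theorem exists_root {V : Type*} {f : V → Option V} (h : PAcyc f)
    (a : V) : ∃ r, f r = none ∧ PReach f a r := by
  obtain ⟨d, hd⟩ := h
  induction hn : d a using Nat.strong_induction_on generalizing a with
  | _ n ih =>
    subst hn
    cases ha : f a with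
    | none => exact ⟨a, ha, Relation.ReflTransGen.refl⟩
    | some b =>
      obtain ⟨r, hr, hb⟩ := ih _ (hd _ _ ha) b rfl
      exact ⟨r, hr, Relation.ReflTransGen.head ha hb⟩

/-- A set closed under adjacency is closed under reachability. -/
theorem reachable_closed {V : Type*} {G : SimpleGraph V} {P : V → Prop}
    (hP : ∀ a b, G.Adj a b → P a → P b) {a b : V} (h : G.Reachable a b) (ha : P a) : P b := by
  obtain ⟨p⟩ := h
  induction p with
  | nil => exact ha
  | cons h _ ih => exact ih (hP _ _ h ha)

/-- Reachability from a vertex to a root is the ancestor relation. -/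
theorem reachable_root {V : Type*} [Fintype V] [DecidableEq V] {f : V → Option V} (h : PAcyc f)
    {a r : V} (hr : f r = none) : (gr (pF f)).Reachable a r ↔ PReach f a r := by
  constructor
  · intro h1
    refine reachable_closed (P := fun x => PReach f x r) ?_ h1.symm Relation.ReflTransGen.refl
    intro x y hxy hx
    rcases (gr_adj_pF f h _ _).1 hxy with h2 | h2
    · rcases (PReach_iff f x r).1 hx with rfl | ⟨w, hw, h3⟩
      · simp [hr] at h2
      · rw [h2] at hw
        cases hw
        exact h3
    · exact Relation.ReflTransGen.head h2 hx
  · exact PReach.reachable h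

theorem root_unique {V : Type*} {f : V → Option V} {a r r' : V}
    (hr : f r = none) (hr' : f r' = none) (h : PReach f a r) (h' : PReach f a r') : r = r' := by
  induction h using Relation.ReflTransGen.head_induction_on with
  | refl =>
    rcases (PReach_iff f _ _).1 h' with rfl | ⟨w, hw, _⟩
    · rfl
    · simp [hr] at hw
  | head h1 _ ih =>
    rcases (PReach_iff f _ _).1 h' with rfl | ⟨w, hw, h3⟩
    · simp [hr'] at h1
    · rw [h1] at hw
      cases hw
      exact ih h3

theorem isForest_of_PAcyc {V : Type*} [Fintype V] [DecidableEq V] (f : V → Option V)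
    (h : PAcyc f) : IsRootedSpanningForest (pF f) (pR f) := by
  refine ⟨?_, ?_, ?_⟩
  · intro e he
    obtain ⟨v, w, hv, rfl⟩ := (Finset.mem_filter.1 he).2
    rw [Sym2.mk_isDiag_iff]
    rintro rfl
    exact h.no_loop hv
  · have key : ∀ v w, f v = some w → ¬ ((gr (pF f)) \ SimpleGraph.fromEdgeSet {s(v, w)}).Reachable v w := by
      intro v w hvw hr
      have h1 : PReach f w v := by
        refine reachable_closed (P := fun x => PReach f x v) ?_ hr Relation.ReflTransGen.refl
        intro x y hxy hx
        rw [SimpleGraph.sdiff_adj, gr_adj_pF f h] at hxy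
        obtain ⟨h1 | h1, h2⟩ := hxy
        · rcases (PReach_iff f x v).1 hx with rfl | ⟨z, hz, h3⟩
          · rw [hvw] at h1
            cases h1
            exfalso
            apply h2
            rw [SimpleGraph.fromEdgeSet_adj]
            refine ⟨rfl, ?_⟩
            rintro rfl
            exact h.no_loop hvw
          · rw [h1] at hz
            cases hz
            exact h3
        · exact Relation.ReflTransGen.head h1 hx
      obtain ⟨d, hd⟩ := h
      have := PReach_rank f d hd h1
      have := hd _ _ hvw
      omega
    rw [SimpleGraph.isAcyclic_iff_forall_adj_isBridge]
    intro v w hvw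
    rcases (gr_adj_pF f h _ _).1 hvw with h1 | h1
    · rw [SimpleGraph.isBridge_iff]
      exact key v w h1
    · rw [Sym2.eq_swap, SimpleGraph.isBridge_iff]
      exact key w v h1
  · intro v
    obtain ⟨r, hr, hv⟩ := exists_root h v
    refine ⟨r, ⟨by simp [pR, hr], hv.reachable h⟩, ?_⟩
    rintro r' ⟨hr', hv'⟩
    have hr'' : f r' = none := by simpa [pR] using hr'
    exact root_unique hr'' hr ((reachable_root h hr'').1 hv') hv

theorem pFR_inj {V : Type*} [Fintype V] [DecidableEq V] {f f' : V → Option V}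
    (h : PAcyc f) (hF : pF f = pF f') (hR : pR f = pR f') : f = f' := by
  have h' := h
  obtain ⟨d, hd⟩ := h
  ext1 v
  induction hn : d v using Nat.strong_induction_on generalizing v with
  | _ n ih =>
    subst hn
    cases hv : f v with
    | none =>
      have : v ∈ pR f := by simp [pR, hv]
      rw [hR] at this
      simpa [pR, eq_comm] using this
    | some w =>
      have : s(v, w) ∈ pF f := (mem_pF f v w).2 (Or.inl hv)
      rw [hF, mem_pF] at this
      rcases this with h1 | h1
      · exact h1.symm
      · rw [← ih _ (hd _ _ hv) w rfl] at h1
        exact (h'.no_two hv h1).elim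

theorem pFR_surj {V : Type*} [Fintype V] [DecidableEq V] (F : Finset (Sym2 V)) (R : Finset V)
    (h : IsRootedSpanningForest F R) : ∃ f : V → Option V, PAcyc f ∧ pF f = F ∧ pR f = R := by
  obtain ⟨hd, hac, hroot⟩ := h
  choose ρ hρ hu using hroot
  simp only at hρ hu
  have hadj : ∀ v w, (gr F).Adj v w → ρ v = ρ w := by
    intro v w hvw
    exact hu w _ ⟨(hρ v).1, hvw.symm.reachable.trans (hρ v).2⟩
  have hnext : ∀ v, v ∉ R → ∃ w, (gr F).Adj v w ∧ (gr F).dist w (ρ w) < (gr F).dist v (ρ v) := by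
    intro v hv
    obtain ⟨p, hp⟩ := (hρ v).2.exists_walk_length_eq_dist
    have hne : v ≠ ρ v := fun h => hv (h ▸ (hρ v).1)
    obtain ⟨w, hvw, q, rfl⟩ := SimpleGraph.Walk.exists_eq_cons_of_ne hne p
    refine ⟨w, hvw, ?_⟩
    rw [← hadj v w hvw, ← hp, SimpleGraph.Walk.length_cons]
    exact Nat.lt_succ_of_le (SimpleGraph.dist_le q)
  choose! nx hnx hlt using hnext
  set f : V → Option V := fun v => if v ∈ R then none else some (nx v) with hf
  have hfs : ∀ v w, f v = some w → v ∉ R ∧ nx v = w := by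
    intro v w hvw
    by_cases hv : v ∈ R
    · simp [hf, hv] at hvw
    · simpa [hf, hv] using hvw
  have hfa : PAcyc f := by
    refine ⟨fun v => (gr F).dist v (ρ v), ?_⟩
    intro v w hvw
    obtain ⟨h1, rfl⟩ := hfs v w hvw
    exact hlt v h1
  have hR : pR f = R := by
    ext v
    by_cases hv : v ∈ R <;> simp [pR, hf, hv]
  have hsub : ∀ v w, f v = some w → (gr F).Adj v w := by
    intro v w hvw
    obtain ⟨h1, rfl⟩ := hfs v w hvw
    exact hnx v h1
  have hsub' : pF f ⊆ F := by
    intro e he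
    obtain ⟨v, w, hv, rfl⟩ := (Finset.mem_filter.1 he).2
    have := hsub v w hv
    rw [SimpleGraph.fromEdgeSet_adj] at this
    exact this.1
  refine ⟨f, hfa, ?_, hR⟩
  refine Finset.Subset.antisymm hsub' ?_
  intro e he
  induction e with
  | _ a b =>
  by_contra hne
  have hab : (gr F).Adj a b := by
    rw [SimpleGraph.fromEdgeSet_adj]
    exact ⟨he, fun h => hd _ he (by rw [Sym2.mk_isDiag_iff]; exact h)⟩
  have hbr := SimpleGraph.isAcyclic_iff_forall_adj_isBridge.1 hac hab
  rw [SimpleGraph.isBridge_iff] at hbr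
  have hle : gr (pF f) ≤ (gr F) \ SimpleGraph.fromEdgeSet {s(a, b)} := by
    intro x y hxy
    rw [SimpleGraph.fromEdgeSet_adj] at hxy
    rw [SimpleGraph.sdiff_adj, SimpleGraph.fromEdgeSet_adj, SimpleGraph.fromEdgeSet_adj]
    refine ⟨⟨hsub' hxy.1, hxy.2⟩, ?_⟩
    rintro ⟨h1, _⟩
    rw [Set.mem_singleton_iff] at h1
    rw [Finset.mem_coe, h1] at hxy
    exact hne hxy.1
  have hle2 : gr (pF f) ≤ gr F := hle.trans sdiff_le
  apply hbr
  refine SimpleGraph.Reachable.mono hle ?_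
  obtain ⟨r, hr, har⟩ := exists_root hfa a
  obtain ⟨s, hs, hbs⟩ := exists_root hfa b
  have hr1 := har.reachable hfa
  have hs1 := hbs.reachable hfa
  have hrR : r ∈ R := by rw [← hR]; simp [pR, hr]
  have hsR : s ∈ R := by rw [← hR]; simp [pR, hs]
  have e1 := hu a r ⟨hrR, hr1.mono hle2⟩
  have e2 := hu b s ⟨hsR, hs1.mono hle2⟩
  have : r = s := by rw [e1, e2, hadj a b hab]
  subst this
  exact hr1.trans hs1.symm

/-- **Theorem 7, part 2** (relative forest-accessibilities of a graph). If
`W = I + L(G)` is invertible with inverse `Q = (q_{ij})`, then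
`q_{ij} = ε(𝔉^{ji}) / ε(𝔉)`. -/
theorem forest_accessibility_graph (n : ℕ) (ε : Fin n → Fin n → ℝ)
    (hsym : ∀ a b, ε a b = ε b a) (hdiag : ∀ a, ε a a = 0)
    (hW : IsUnit (1 + lap ε)) (i j : Fin n) :
    (1 + lap ε)⁻¹ i j
      = (∑ FR ∈ rootedForestsSame j i, edgeWt ε hsym FR.1)
          / (∑ FR ∈ rootedForests (Fin n), edgeWt ε hsym FR.1) := by
  have hD : ∑ FR ∈ rootedForests (Fin n), edgeWt ε hsym FR.1 = (1 + lap ε).det := by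
    rw [det_W]
    symm
    refine Finset.sum_bij (fun f _ => (pF f, pR f)) ?_ ?_ ?_ ?_
    · intro f hf
      simpa [rootedForests] using isForest_of_PAcyc f (Finset.mem_filter.1 hf).2
    · intro f hf f' _ he
      rw [Prod.mk.injEq] at he
      exact pFR_inj (Finset.mem_filter.1 hf).2 he.1 he.2
    · rintro ⟨F, R⟩ h
      obtain ⟨f, hf, rfl, rfl⟩ := pFR_surj F R (Finset.mem_filter.1 h).2
      exact ⟨f, by simpa using hf, rfl⟩
    · intro f hf
      exact (edgeWt_pF ε hsym f (Finset.mem_filter.1 hf).2).symm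
  have hN : ∑ FR ∈ rootedForestsSame j i, edgeWt ε hsym FR.1 = (1 + lap ε).adjugate i j := by
    rw [adj_W]
    symm
    refine Finset.sum_bij (fun f _ => (pF f, pR f)) ?_ ?_ ?_ ?_
    · intro f hf
      obtain ⟨h1, h2, h3⟩ := (Finset.mem_filter.1 hf).2
      refine Finset.mem_filter.2 ⟨Finset.mem_univ _, isForest_of_PAcyc f h1, ?_, ?_⟩
      · exact (h3.reachable h1).symm
      · simp [pR, h2]
    · intro f hf f' _ he
      rw [Prod.mk.injEq] at he
      exact pFR_inj (Finset.mem_filter.1 hf).2.1 he.1 he.2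
    · rintro ⟨F, R⟩ h
      obtain ⟨h1, h2, h3⟩ := (Finset.mem_filter.1 h).2
      obtain ⟨f, hf, rfl, rfl⟩ := pFR_surj F R h1
      have h4 : f j = none := by simpa [pR] using h3
      exact ⟨f, Finset.mem_filter.2 ⟨Finset.mem_univ _, hf, h4,
        (reachable_root hf h4).1 h2.symm⟩, rfl⟩
    · intro f hf
      exact (edgeWt_pF ε hsym f (Finset.mem_filter.1 hf).2.1).symm
  rw [hD, hN, Matrix.inv_def, Matrix.smul_apply, Ring.inverse_eq_inv', smul_eq_mul,
    div_eq_inv_mul]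
end

section
/- Counting rooted forests of a simple graph (determinant form). For any finite simple graph G on n vertices, the determinant of the matrix W = I + L(G), where L(G) is the Laplacian matrix of G, equals the number of spanning rooted forests of G. -/
open scoped Classical

/-- The row attached to the choice `o` (a parent, or no parent) at vertex `i`. -/
noncomputable def forestRow {n : ℕ} (i : Fin n) (o : Option (Fin n)) : Fin n → ℝ :=
  fun j => (if i = j then 1 else 0) - (if o = some j then 1 else 0)

/-- A partial function is acyclic when following it always terminates. -/
def AcyclicFun {n : ℕ} (f : Fin n → Option (Fin n)) : Prop :=
  WellFounded (fun u v => f v = some u)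

/-- The edges of the functional graph. -/
noncomputable def funEdges {n : ℕ} (f : Fin n → Option (Fin n)) : Finset (Sym2 (Fin n)) :=
  Finset.univ.filter fun e => ∃ i u, f i = some u ∧ e = s(i, u)

/-- The roots of the functional graph. -/
noncomputable def funRoots {n : ℕ} (f : Fin n → Option (Fin n)) : Finset (Fin n) :=
  Finset.univ.filter fun v => f v = none

lemma det_forest_one {n : ℕ} (f : Fin n → Option (Fin n)) (h : AcyclicFun f) :
    (Matrix.of fun i => forestRow i (f i)).det = 1 := by
  have : IsWellFounded (Fin n) (fun u v => f v = some u) := ⟨h⟩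
  obtain ⟨rk, hlt⟩ : ∃ rk : Fin n → Ordinal, ∀ u v, f v = some u → rk u < rk v :=
    ⟨IsWellFounded.rank (fun u v => f v = some u),
      fun u v huv => IsWellFounded.rank_lt_of_rel (r := fun u v => f v = some u) huv⟩
  have hb : (Matrix.of fun i => forestRow i (f i)).BlockTriangular
      (fun v => OrderDual.toDual (rk v)) := by
    intro i j hij
    have hij' : rk i < rk j := hij
    have h1 : i ≠ j := by rintro rfl; exact lt_irrefl _ hij'
    have h2 : f i ≠ some j := fun hh => lt_asymm hij' (hlt _ _ hh)
    simp [forestRow, h1, h2]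
  rw [hb.det]
  apply Finset.prod_eq_one
  intro a _
  have : (Matrix.of fun i => forestRow i (f i)).toSquareBlock
      (fun v => OrderDual.toDual (rk v)) a = 1 := by
    ext ⟨i, hi⟩ ⟨j, hj⟩
    have h2 : f i ≠ some j := by
      intro hh
      have := hlt _ _ hh
      have h3 : rk i = rk j := OrderDual.toDual.injective (hi.trans hj.symm)
      exact absurd this (by rw [h3]; exact lt_irrefl _)
    simp [Matrix.toSquareBlock_def, forestRow, h2, Matrix.one_apply]
  rw [this, Matrix.det_one]

lemma det_forest_zero {n : ℕ} (f : Fin n → Option (Fin n)) (h : ¬ AcyclicFun f) :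
    (Matrix.of fun i => forestRow i (f i)).det = 0 := by
  apply Matrix.exists_mulVec_eq_zero_iff.mp
  let r : Fin n → Fin n → Prop := fun u v => f v = some u
  have hx : ∃ v, ¬ Acc r v := by
    by_contra hc
    push Not at hc
    exact h ⟨hc⟩
  obtain ⟨v, hv⟩ := hx
  refine ⟨fun v => if Acc r v then 0 else 1, ?_, ?_⟩
  · intro h0
    have := congrFun h0 v
    simp [hv] at this
  · ext i
    simp only [Matrix.mulVec, dotProduct, Matrix.of_apply, forestRow, sub_mul, ite_mul, one_mul,
      zero_mul, Finset.sum_sub_distrib, Finset.sum_ite_eq, Finset.mem_univ, if_true, Pi.zero_apply]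
    rcases hfi : f i with _ | u
    · have : Acc r i := ⟨_, fun y hy => by simp [r, hfi] at hy⟩
      simp [this]
    · have : Acc r i ↔ Acc r u := by
        constructor
        · intro hi; exact hi.inv hfi
        · intro hu
          refine ⟨_, fun y hy => ?_⟩
          have : u = y := by simpa [r, hfi] using hy
          exact this ▸ hu
      simp [this]

lemma det_expand_s11 {n : ℕ} (G : SimpleGraph (Fin n)) [DecidableRel G.Adj] :
    (1 + G.lapMatrix ℝ).det = ∑ f ∈ Fintype.piFinset
      (fun i => Finset.insertNone (G.neighborFinset i)),
      (Matrix.of fun i => forestRow i (f i)).det := by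
  have h1 : (1 + G.lapMatrix ℝ) = Matrix.of fun i =>
      ∑ o ∈ Finset.insertNone (G.neighborFinset i), forestRow i o := by
    ext i j
    simp only [Matrix.of_apply, Finset.sum_insertNone, Pi.add_apply, Finset.sum_apply,
      SimpleGraph.lapMatrix, SimpleGraph.degMatrix, Matrix.add_apply, Matrix.sub_apply,
      Matrix.one_apply, Matrix.diagonal_apply, SimpleGraph.adjMatrix_apply]
    have e : ∀ c, forestRow i (some c) j =
        (if i = j then (1 : ℝ) else 0) - (if c = j then 1 else 0) := by
      intro c; simp [forestRow]
    have e0 : forestRow i none j = if i = j then (1 : ℝ) else 0 := by simp [forestRow]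
    simp only [e, e0, Finset.sum_sub_distrib, Finset.sum_const, Finset.sum_ite_eq',
      SimpleGraph.mem_neighborFinset, SimpleGraph.card_neighborFinset_eq_degree]
    split_ifs <;> simp_all
  rw [h1]
  have h2 := (Matrix.detRowAlternating (R := ℝ) (n := Fin n)).toMultilinearMap.map_sum_finset
    (fun i o => forestRow i o) (fun i => Finset.insertNone (G.neighborFinset i))
  convert h2 using 2
  all_goals rfl

lemma funEdges_adj {n : ℕ} {f : Fin n → Option (Fin n)} (h : AcyclicFun f) {i u : Fin n}
    (hi : f i = some u) :
    (SimpleGraph.fromEdgeSet (↑(funEdges f) : Set (Sym2 (Fin n)))).Adj i u := by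
  rw [SimpleGraph.fromEdgeSet_adj]
  refine ⟨?_, ?_⟩
  · simp only [funEdges, Finset.coe_filter, Set.mem_ofPred_eq, Finset.mem_univ, true_and]
    exact ⟨i, u, hi, rfl⟩
  · rintro rfl
    exact h.irrefl.irrefl i hi

lemma funEdges_adj_cases {n : ℕ} {f : Fin n → Option (Fin n)} {a b : Fin n}
    (hab : s(a, b) ∈ funEdges f) : f a = some b ∨ f b = some a := by
  simp only [funEdges, Finset.mem_filter, Finset.mem_univ, true_and] at hab
  obtain ⟨i, u, hi, he⟩ := hab
  rcases Sym2.eq_iff.mp he with ⟨rfl, rfl⟩ | ⟨rfl, rfl⟩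
  · exact Or.inl hi
  · exact Or.inr hi

lemma exists_root_s11 {n : ℕ} {f : Fin n → Option (Fin n)} (h : AcyclicFun f) (v : Fin n) :
    ∃ r, r ∈ funRoots f ∧ Relation.ReflTransGen (fun a b => f a = some b) v r := by
  induction v using h.induction with
  | _ v ih =>
    rcases hv : f v with _ | u
    · exact ⟨v, by simp [funRoots, hv], Relation.ReflTransGen.refl⟩
    · obtain ⟨r, hr, hur⟩ := ih u hv
      exact ⟨r, hr, Relation.ReflTransGen.head hv hur⟩

lemma reach_of_rtg {n : ℕ} {f : Fin n → Option (Fin n)} (h : AcyclicFun f) {v r : Fin n}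
    (hv : Relation.ReflTransGen (fun a b => f a = some b) v r) :
    (SimpleGraph.fromEdgeSet (↑(funEdges f) : Set (Sym2 (Fin n)))).Reachable v r := by
  induction hv with
  | refl => exact SimpleGraph.Reachable.refl _
  | tail _ hbc ih => exact ih.trans (funEdges_adj h hbc).reachable

lemma inv_of_reach {V : Type*} {H : SimpleGraph V} {P : V → Prop}
    (hP : ∀ a b, H.Adj a b → (P a ↔ P b)) {a b : V} (h : H.Reachable a b) : P a ↔ P b := by
  obtain ⟨w⟩ := h
  induction w with
  | nil => rfl
  | cons hadj _ ih => exact (hP _ _ hadj).trans ih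

lemma rtg_step {n : ℕ} {f : Fin n → Option (Fin n)} {j u i : Fin n} (hj : f j = some u)
    (hne : j ≠ i) : Relation.ReflTransGen (fun a b => f a = some b) j i ↔
      Relation.ReflTransGen (fun a b => f a = some b) u i := by
  constructor
  · intro h
    rcases Relation.ReflTransGen.cases_head h with h | ⟨c, hc, hci⟩
    · exact absurd h hne
    · have : u = c := by simpa [hj] using hc
      exact this ▸ hci
  · exact fun h => Relation.ReflTransGen.head hj h

lemma not_rtg_back {n : ℕ} {f : Fin n → Option (Fin n)} (h : AcyclicFun f) {i u : Fin n}
    (hi : f i = some u) : ¬ Relation.ReflTransGen (fun a b => f a = some b) u i := by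
  intro hr
  have ht : Relation.TransGen (fun a b => f a = some b) i i := Relation.TransGen.head' hi hr
  have ht' : Relation.TransGen (fun u v => f v = some u) i i := by
    rw [← Relation.transGen_swap] at ht
    exact ht
  exact (WellFounded.transGen h).irrefl.irrefl i ht'

lemma rooted_of_fun {n : ℕ} {f : Fin n → Option (Fin n)} (h : AcyclicFun f) :
    IsRootedSpanningForest (funEdges f) (funRoots f) := by
  refine ⟨?_, ?_, ?_⟩
  · intro e he
    simp only [funEdges, Finset.mem_filter, Finset.mem_univ, true_and] at he
    obtain ⟨i, u, hi, rfl⟩ := he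
    exact fun hd => (funEdges_adj h hi).ne hd
  · rw [SimpleGraph.isAcyclic_iff_forall_adj_isBridge]
    have key : ∀ i u, f i = some u →
        (SimpleGraph.fromEdgeSet (↑(funEdges f) : Set (Sym2 (Fin n)))).IsBridge s(i, u) := by
      intro i u hi
      rw [SimpleGraph.isBridge_iff]
      intro hr
      have := (inv_of_reach (P := fun v => Relation.ReflTransGen (fun a b => f a = some b) v i)
        ?_ hr).mp Relation.ReflTransGen.refl
      · exact not_rtg_back h hi this
      · intro a b hab
        rw [SimpleGraph.deleteEdges_adj, SimpleGraph.fromEdgeSet_adj] at hab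
        obtain ⟨⟨hab, _⟩, hne⟩ := hab
        rcases funEdges_adj_cases hab with hf | hf
        · apply rtg_step hf
          rintro rfl
          have : u = b := by simpa [hi] using hf
          exact hne (by simp [this])
        · symm
          apply rtg_step hf
          rintro rfl
          have : u = a := by simpa [hi] using hf
          exact hne (by simp [this, Sym2.eq_swap])
    intro a b hab
    rw [SimpleGraph.fromEdgeSet_adj] at hab
    rcases funEdges_adj_cases hab.1 with hf | hf
    · exact key _ _ hf
    · rw [Sym2.eq_swap]; exact key _ _ hf
  · intro v
    obtain ⟨r, hr, hvr⟩ := exists_root_s11 h v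
    refine ⟨r, ⟨hr, reach_of_rtg h hvr⟩, ?_⟩
    rintro s ⟨hs, hvs⟩
    simp only [funRoots, Finset.mem_filter, Finset.mem_univ, true_and] at hs hr
    have := (inv_of_reach (P := fun v => Relation.ReflTransGen (fun a b => f a = some b) v r)
        ?_ hvs).mp hvr
    · rcases Relation.ReflTransGen.cases_head this with h | ⟨c, hc, _⟩
      · exact h
      · simp [hs] at hc
    · intro a b hab
      rw [SimpleGraph.fromEdgeSet_adj] at hab
      rcases funEdges_adj_cases hab.1 with hf | hf
      · apply rtg_step hf
        rintro rfl; simp [hr] at hf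
      · symm
        apply rtg_step hf
        rintro rfl; simp [hr] at hf

lemma fun_inj {n : ℕ} {f g : Fin n → Option (Fin n)} (hf : AcyclicFun f)
    (hE : funEdges f = funEdges g) (hR : funRoots f = funRoots g) : f = g := by
  funext v
  induction v using hf.induction with
  | _ v ih =>
    rcases hv : f v with _ | u
    · have : v ∈ funRoots g := by rw [← hR]; simp [funRoots, hv]
      simp only [funRoots, Finset.mem_filter, Finset.mem_univ, true_and] at this
      exact this.symm
    · have hu := ih u hv
      have he : s(v, u) ∈ funEdges g := by
        rw [← hE]; simp only [funEdges, Finset.mem_filter, Finset.mem_univ, true_and]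
        exact ⟨v, u, hv, rfl⟩
      rcases funEdges_adj_cases he with h | h
      · exact h.symm
      · rw [← hu] at h
        exact absurd (Relation.ReflTransGen.single (r := fun a b => f a = some b) h) (not_rtg_back hf hv)

lemma fun_surj {n : ℕ} {F : Finset (Sym2 (Fin n))} {R : Finset (Fin n)}
    (h : IsRootedSpanningForest F R) :
    ∃ f : Fin n → Option (Fin n), AcyclicFun f ∧ funEdges f = F ∧ funRoots f = R := by
  obtain ⟨hd, hac, hroot⟩ := h
  set H := SimpleGraph.fromEdgeSet (↑F : Set (Sym2 (Fin n))) with hH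
  choose ρ hρ hρu using hroot
  have hstep : ∀ v, ∃ o : Option (Fin n), (v ∈ R → o = none) ∧
      (v ∉ R → ∃ u, o = some u ∧ H.Adj v u ∧ H.dist u (ρ v) < H.dist v (ρ v)) := by
    intro v
    by_cases hv : v ∈ R
    · exact ⟨none, fun _ => rfl, fun h => absurd hv h⟩
    · obtain ⟨w, hw⟩ := (hρ v).2.exists_walk_length_eq_dist
      generalize hr : ρ v = r at w hw
      cases w with
      | nil => exact absurd (hr ▸ (hρ v).1) hv
      | @cons _ u _ hadj p =>
        refine ⟨some u, fun h => absurd h hv, fun _ => ⟨u, rfl, hadj, ?_⟩⟩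
        have := SimpleGraph.dist_le p
        rw [← hw, SimpleGraph.Walk.length_cons]
        omega
  choose f hf1 hf2 using hstep
  have hsame : ∀ a b, H.Adj a b → ρ a = ρ b := by
    intro a b hab
    exact hρu b _ ⟨(hρ a).1, hab.symm.reachable.trans (hρ a).2⟩
  have hfs : ∀ v u, f v = some u → H.Adj v u ∧ H.dist u (ρ v) < H.dist v (ρ v) := by
    intro v u hvu
    have hv : v ∉ R := fun hv => by simp [hf1 v hv] at hvu
    obtain ⟨u', hu', h⟩ := hf2 v hv
    have : u = u' := by simpa [hvu] using hu'
    exact this ▸ h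
  have hacy : AcyclicFun f := by
    apply Subrelation.wf (r := InvImage (· < ·) (fun v => H.dist v (ρ v))) _ (InvImage.wf _ wellFounded_lt)
    intro u v huv
    have := hfs v u huv
    show H.dist u (ρ u) < H.dist v (ρ v)
    rw [← hsame v u this.1]
    exact this.2
  have hRR : funRoots f = R := by
    ext v
    simp only [funRoots, Finset.mem_filter, Finset.mem_univ, true_and]
    constructor
    · intro hv
      by_contra hvR
      obtain ⟨u, hu, _⟩ := hf2 v hvR
      simp [hv] at hu
    · exact hf1 v
  have hsub : funEdges f ⊆ F := by
    intro e he
    simp only [funEdges, Finset.mem_filter, Finset.mem_univ, true_and] at he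
    obtain ⟨i, u, hi, rfl⟩ := he
    have := (hfs i u hi).1
    rw [hH, SimpleGraph.fromEdgeSet_adj] at this
    exact this.1
  refine ⟨f, hacy, Finset.Subset.antisymm hsub ?_, hRR⟩
  intro e he
  induction e using Sym2.ind with
  | _ a b =>
    by_contra hne
    have hab : H.Adj a b := by
      rw [hH, SimpleGraph.fromEdgeSet_adj]
      exact ⟨he, fun h => hd _ he h⟩
    have hbr := SimpleGraph.isAcyclic_iff_forall_adj_isBridge.mp hac hab
    rw [SimpleGraph.isBridge_iff] at hbr
    apply hbr
    have hle : SimpleGraph.fromEdgeSet (↑(funEdges f) : Set (Sym2 (Fin n))) ≤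
        H.deleteEdges {s(a, b)} := by
      intro x y hxy
      rw [SimpleGraph.fromEdgeSet_adj] at hxy
      rw [SimpleGraph.deleteEdges_adj, hH, SimpleGraph.fromEdgeSet_adj]
      refine ⟨⟨hsub hxy.1, hxy.2⟩, ?_⟩
      intro hh
      rw [Set.mem_singleton_iff] at hh
      exact hne (hh ▸ hxy.1)
    have hto : ∀ v, (H.deleteEdges {s(a, b)}).Reachable v (ρ v) := by
      intro v
      obtain ⟨r, hr, hvr⟩ := exists_root_s11 hacy v
      have h1 := (reach_of_rtg hacy hvr).mono hle
      have h2 : r = ρ v := hρu v r ⟨hRR ▸ hr, h1.mono (SimpleGraph.deleteEdges_le _)⟩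
      exact h2 ▸ h1
    exact (hto a).trans (hsame a b hab ▸ (hto b).symm)

/-- **Counting rooted forests of a simple graph (determinant form).** For any finite
simple graph `G` on `n` vertices, `det (I + L(G))` equals the number of spanning rooted
forests of `G`. -/
theorem count_rooted_forests_det (n : ℕ) (G : SimpleGraph (Fin n))
    [DecidableRel G.Adj] :
    (1 + G.lapMatrix ℝ).det
      = ((Finset.univ.filter fun FR : Finset (Sym2 (Fin n)) × Finset (Fin n) =>
            FR.1 ⊆ G.edgeFinset ∧ IsRootedSpanningForest FR.1 FR.2).card : ℝ) := by
  rw [det_expand_s11]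
  have h1 : ∀ f : Fin n → Option (Fin n), (Matrix.of fun i => forestRow i (f i)).det
      = if AcyclicFun f then (1 : ℝ) else 0 := by
    intro f
    split_ifs with h
    · exact det_forest_one f h
    · exact det_forest_zero f h
  simp only [h1]
  rw [Finset.sum_boole]
  congr 1
  apply Finset.card_bij (fun f _ => (funEdges f, funRoots f))
  · intro f hf
    simp only [Finset.mem_filter, Fintype.mem_piFinset, Finset.mem_univ, true_and] at hf ⊢
    refine ⟨?_, rooted_of_fun hf.2⟩
    intro e he
    simp only [funEdges, Finset.mem_filter, Finset.mem_univ, true_and] at he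
    obtain ⟨i, u, hi, rfl⟩ := he
    have := hf.1 i
    rw [hi, Finset.some_mem_insertNone, SimpleGraph.mem_neighborFinset] at this
    rw [SimpleGraph.mem_edgeFinset]
    exact this
  · intro f hf g hg hfg
    simp only [Finset.mem_filter] at hf
    rw [Prod.mk.injEq] at hfg
    exact fun_inj hf.2 hfg.1 hfg.2
  · rintro ⟨F, R⟩ hFR
    simp only [Finset.mem_filter, Finset.mem_univ, true_and] at hFR
    obtain ⟨f, hf, rfl, rfl⟩ := fun_surj hFR.2
    refine ⟨f, ?_, rfl⟩
    simp only [Finset.mem_filter, Fintype.mem_piFinset]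
    refine ⟨fun i => ?_, hf⟩
    rcases hi : f i with _ | u
    · simp
    · rw [Finset.some_mem_insertNone, SimpleGraph.mem_neighborFinset]
      have : s(i, u) ∈ G.edgeFinset := by
        apply hFR.1
        simp only [funEdges, Finset.mem_filter, Finset.mem_univ, true_and]
        exact ⟨i, u, hi, rfl⟩
      rw [SimpleGraph.mem_edgeFinset] at this
      exact this
end
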